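/- arXiv:2103.08665 — 3 statements merged into one kernel-verified Lean document; each statement's English description precedes it below -/
import Mathlib

section
/- For any dimension d ≥ 2 and any n ≥ d+1, the total number D(n,d) of Tukey depth histograms of n-point sets in general position in R^d equals (2/(n-d+2))·C(3(n-d)/2 + 1, (n-d)/2) when n-d is even, and (3/(n-d+2))·C((3(n-d)+1)/2, (n-d-1)/2) when n-d is odd. -/
/-- `numHist n d l` is the number of depth histograms `(D 1, …, D l)` of nonnegative
integers with `D l > 0`, total sum `n`, and `D 1 + ⋯ + D (i-1) ≥ 2i + d - 3` for every
`2 ≤ i ≤ l` with `D i > 0`. -/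
noncomputable def numHist (n d l : ℕ) : ℕ :=
  Set.ncard {D : ℕ → ℕ |
    (∀ j, j = 0 ∨ l < j → D j = 0) ∧ 0 < D l ∧
    (∑ j ∈ Finset.Icc 1 l, D j) = n ∧
    ∀ i, 2 ≤ i → 0 < D i → 2 * i + d - 3 ≤ ∑ j ∈ Finset.Icc 1 (i - 1), D j}

/-- `numHistTotal n d` is the total number of Tukey depth histograms of `n`-point sets in
general position in `ℝ^d`: vectors of nonnegative integers, indexed by depths `1, …, n`,
with total sum `n` and satisfying `D 1 + ⋯ + D (i-1) ≥ 2i + d - 3` for every `i ≥ 2`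
with `D i > 0`.  (Any valid histogram automatically has no nonzero entry beyond `n`.) -/
noncomputable def numHistTotal (n d : ℕ) : ℕ :=
  Set.ncard {D : ℕ → ℕ |
    (∀ j, j = 0 ∨ n < j → D j = 0) ∧
    (∑ j ∈ Finset.Icc 1 n, D j) = n ∧
    ∀ i, 2 ≤ i → 0 < D i → 2 * i + d - 3 ≤ ∑ j ∈ Finset.Icc 1 (i - 1), D j}


/-- Histograms of length `i` and total sum `s`. -/
def HS (d i s : ℕ) : Set (ℕ → ℕ) :=
  {D : ℕ → ℕ |
    (∀ j, j = 0 ∨ i < j → D j = 0) ∧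
    (∑ j ∈ Finset.Icc 1 i, D j) = s ∧
    ∀ i, 2 ≤ i → 0 < D i → 2 * i + d - 3 ≤ ∑ j ∈ Finset.Icc 1 (i - 1), D j}

/-- Increase the entry at `i` by one. -/
def incAt (i : ℕ) (D : ℕ → ℕ) : ℕ → ℕ := fun j => D j + if j = i then 1 else 0

theorem incAt_injective (i : ℕ) : Function.Injective (incAt i) := by
  intro D E h
  funext j
  have := congrFun h j
  simpa [incAt] using this

theorem sum_incAt_lt (i k : ℕ) (h : k < i) (D : ℕ → ℕ) :
    ∑ j ∈ Finset.Icc 1 k, incAt i D j = ∑ j ∈ Finset.Icc 1 k, D j := by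
  apply Finset.sum_congr rfl
  intro j hj
  rw [Finset.mem_Icc] at hj
  have : j ≠ i := by omega
  simp [incAt, this]

theorem HS_sub {d i s : ℕ} {D : ℕ → ℕ} (h : D (i + 1) = 0) :
    D ∈ HS d (i + 1) s ↔ D ∈ HS d i s := by
  unfold HS
  simp only [Set.mem_ofPred_eq]
  rw [Finset.sum_Icc_succ_top (by omega), h, add_zero]
  constructor
  · rintro ⟨h1, h2, h3⟩
    refine ⟨fun j hj => ?_, h2, h3⟩
    by_cases e : j = i + 1
    · rw [e, h]
    · exact h1 j (by omega)
  · rintro ⟨h1, h2, h3⟩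
    exact ⟨fun j hj => h1 j (by omega), h2, h3⟩

theorem HS_step_le {d i s : ℕ} (hi : 1 ≤ i) (hs : s + 1 ≤ 2 * i + d) :
    HS d (i + 1) s = HS d i s := by
  ext D
  constructor
  · intro hD
    have h0 : D (i + 1) = 0 := by
      obtain ⟨h1, h2, h3⟩ := hD
      by_contra hne
      have := h3 (i + 1) (by omega) (by omega)
      rw [Finset.sum_Icc_succ_top (by omega)] at h2
      simp only [Nat.add_sub_cancel] at this
      omega
    exact (HS_sub h0).1 hD
  · intro hD
    exact (HS_sub (hD.1 _ (by omega))).2 hD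

theorem HS_step_gt {d i s : ℕ} (hi : 1 ≤ i) (hs : 2 * i + d ≤ s + 1) :
    HS d (i + 1) (s + 1) = HS d i (s + 1) ∪ Set.image (incAt (i + 1)) (HS d (i + 1) s) := by
  ext D
  constructor
  · intro hD
    by_cases h0 : D (i + 1) = 0
    · exact Or.inl ((HS_sub h0).1 hD)
    · right
      obtain ⟨h1, h2, h3⟩ := hD
      obtain ⟨E, rfl⟩ : ∃ E, D = incAt (i + 1) E := by
        refine ⟨fun j => D j - if j = i + 1 then 1 else 0, ?_⟩
        funext j
        by_cases e : j = i + 1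
        · subst e; simp [incAt]; omega
        · simp [incAt, e]
      refine ⟨E, ⟨fun j hj => ?_, ?_, fun j hj hp => ?_⟩, rfl⟩
      · have := h1 j hj
        simp [incAt] at this; exact this.1
      · rw [Finset.sum_Icc_succ_top (by omega), sum_incAt_lt _ _ (by omega)] at h2
        rw [Finset.sum_Icc_succ_top (by omega)]
        simp [incAt] at h2
        omega
      · by_cases hj' : j ≤ i + 1
        · have := h3 j hj (by simp [incAt]; omega)
          rwa [sum_incAt_lt _ _ (by omega)] at this
        · have := h1 j (by omega)
          simp [incAt] at this
          omega
  · rintro (hD | ⟨E, ⟨h1, h2, h3⟩, rfl⟩)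
    · exact (HS_sub (hD.1 _ (by omega))).2 hD
    · have h2' := h2
      rw [Finset.sum_Icc_succ_top (by omega)] at h2'
      refine ⟨fun j hj => ?_, ?_, fun j hj hp => ?_⟩
      · have : j ≠ i + 1 := by omega
        simp [incAt, this, h1 j hj]
      · rw [Finset.sum_Icc_succ_top (by omega), sum_incAt_lt _ _ (by omega)]
        simp [incAt]
        omega
      · have hj' : j ≤ i + 1 := by
          by_contra hc
          have e : j ≠ i + 1 := by omega
          simp [incAt, e, h1 j (by omega)] at hp
        rw [sum_incAt_lt _ _ (by omega)]
        by_cases hE : 0 < E j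
        · exact h3 j hj hE
        · have e : j = i + 1 := by
            by_contra e
            simp [incAt, e] at hp
            omega
          subst e
          simp only [Nat.add_sub_cancel]
          omega

theorem HS_one (d s : ℕ) : (HS d 1 s).encard = 1 := by
  rw [Set.encard_eq_one]
  refine ⟨fun j => if j = 1 then s else 0, ?_⟩
  ext D
  rw [Set.mem_singleton_iff]
  constructor
  · rintro ⟨h1, h2, h3⟩
    funext j
    by_cases e : j = 1
    · subst e; simpa using h2
    · simp [e, h1 j (by omega)]
  · rintro rfl
    refine ⟨fun j hj => ?_, by simp, fun j hj hp => ?_⟩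
    · have : j ≠ 1 := by omega
      simp [this]
    · have : j ≠ 1 := by omega
      simp [this] at hp

theorem HS_card (d b : ℕ) : ∀ k s : ℕ, s + 1 = d + 2 * b + k →
    ∃ v : ℕ, (HS d (b + 1) s).encard = v ∧
      v * (2 * b + k + 1) = (k + 1) * Nat.choose (3 * b + k) b := by
  induction b with
  | zero =>
    intro k s _
    exact ⟨1, by simpa using HS_one d s, by simp⟩
  | succ b ihb =>
    intro k
    induction k with
    | zero =>
      intro s hs
      obtain ⟨v, hv, hv2⟩ := ihb 2 s (by omega)
      refine ⟨v, ?_, ?_⟩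
      · rw [HS_step_le (by omega) (by omega), hv]
      · have h := Nat.add_one_mul_choose_eq (3 * b + 2) b
        have e : 3 * (b + 1) + 0 = 3 * b + 2 + 1 := by ring
        rw [e]
        have : (b + 1) * (v * (2 * (b + 1) + 0 + 1)) =
            (b + 1) * ((0 + 1) * (3 * b + 2 + 1).choose (b + 1)) := by
          linear_combination (b + 1) * hv2 + h
        exact Nat.eq_of_mul_eq_mul_left (by omega) this
    | succ k ihk =>
      intro s hs
      obtain ⟨s, rfl⟩ : ∃ t, s = t + 1 := ⟨s - 1, by omega⟩
      obtain ⟨v, hv, hv2⟩ := ihb (k + 3) (s + 1) (by omega)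
      obtain ⟨w, hw, hw2⟩ := ihk s (by omega)
      refine ⟨v + w, ?_, ?_⟩
      · rw [HS_step_gt (by omega) (by omega), Set.encard_union_eq,
          (incAt_injective _).encard_image, hv, hw]
        · push_cast; rfl
        · rw [Set.disjoint_left]
          rintro D hD ⟨E, hE, rfl⟩
          have := hD.1 (b + 1 + 1) (by omega)
          simp [incAt] at this
      · have e1 : 3 * b + (k + 3) = 3 * b + k + 3 := by ring
        have e2 : 3 * (b + 1) + k = 3 * b + k + 3 := by ring
        have e3 : 3 * (b + 1) + (k + 1) = 3 * b + k + 3 + 1 := by ring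
        rw [e1] at hv2
        rw [e2] at hw2
        rw [e3, Nat.choose_succ_succ]
        have h := Nat.choose_succ_right_eq (3 * b + k + 3) b
        have e4 : 3 * b + k + 3 - b = 2 * b + k + 3 := by omega
        rw [e4] at h
        generalize (3 * b + k + 3).choose b = X at *
        generalize (3 * b + k + 3).choose (b + 1) = Y at *
        have hq : (v : ℚ) * (2 * b + (k + 3) + 1) = (k + 3 + 1) * X := by exact_mod_cast hv2
        have wq : (w : ℚ) * (2 * (b + 1) + k + 1) = (k + 1) * Y := by exact_mod_cast hw2
        have h' : (Y : ℚ) * (b + 1) = X * (2 * b + k + 3) := by exact_mod_cast h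
        have hb : (2 * (b : ℚ) + k + 3) ≠ 0 := by positivity
        have hX : (X : ℚ) = Y * (b + 1) / (2 * b + k + 3) := by
          rw [eq_div_iff hb]; linarith
        have hv' : (v : ℚ) = (k + 4) * X / (2 * b + k + 4) := by
          rw [eq_div_iff (by positivity)]; linarith
        have hw' : (w : ℚ) = (k + 1) * Y / (2 * b + k + 3) := by
          rw [eq_div_iff (by positivity)]; linarith
        have : ((v : ℚ) + w) * (2 * (b + 1) + (k + 1) + 1) = (k + 1 + 1) * (X + Y) := by
          rw [hv', hw', hX]
          field_simp
          ring
        exact_mod_cast this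

theorem HS_stable {d i s : ℕ} (hi : 1 ≤ i) (hs : s + 1 ≤ 2 * i + d) (t : ℕ) :
    HS d (i + t) s = HS d i s := by
  induction t with
  | zero => rfl
  | succ t ih => rw [← add_assoc, HS_step_le (by omega) (by omega), ih]

theorem total_card (d b k n : ℕ) (hn : n + 1 = d + 2 * b + k) (hk : k ≤ 1) (hb : b + 1 ≤ n) :
    numHistTotal n d * (2 * b + k + 1) = (k + 1) * Nat.choose (3 * b + k) b := by
  obtain ⟨v, hv, hv2⟩ := HS_card d b k n hn
  have h : HS d n n = HS d (b + 1) n := by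
    have := HS_stable (d := d) (i := b + 1) (s := n) (by omega) (by omega) (n - (b + 1))
    rwa [show b + 1 + (n - (b + 1)) = n by omega] at this
  have : numHistTotal n d = v := by
    change (HS d n n).ncard = v
    rw [h, Set.ncard, hv]
    rfl
  rw [this, hv2]

theorem numHistTotal_formula {n d : ℕ} (hd : 2 ≤ d) (hn : d + 1 ≤ n) :
    (if Even (n - d) then
      (numHistTotal n d : ℚ) =
        (2 / ((n : ℚ) - d + 2)) * Nat.choose (3 * ((n - d) / 2) + 1) ((n - d) / 2)
    else
      (numHistTotal n d : ℚ) =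
        (3 / ((n : ℚ) - d + 2)) * Nat.choose ((3 * (n - d) + 1) / 2) ((n - d - 1) / 2)) := by
  obtain ⟨m, rfl⟩ : ∃ m, n = d + m := ⟨n - d, by omega⟩
  rw [show d + m - d = m by omega]
  have hc : ((d + m : ℕ) : ℚ) - d + 2 = m + 2 := by push_cast; ring
  rw [hc]
  have hm : ((m : ℚ) + 2) ≠ 0 := by positivity
  rcases Nat.even_or_odd' m with ⟨p, rfl | rfl⟩
  · rw [if_pos (by simp), show 2 * p / 2 = p by omega]
    have h := total_card d p 1 (d + 2 * p) (by omega) (by omega) (by omega)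
    have h' : (numHistTotal (d + 2 * p) d : ℚ) * (2 * p + 1 + 1)
        = (1 + 1) * (3 * p + 1).choose p := by exact_mod_cast h
    rw [div_mul_eq_mul_div, eq_div_iff hm]
    push_cast
    linarith
  · rw [if_neg (by simp), show (3 * (2 * p + 1) + 1) / 2 = 3 * p + 2 by omega,
      show (2 * p + 1 - 1) / 2 = p by omega]
    have h := total_card d (p + 1) 0 (d + (2 * p + 1)) (by omega) (by omega) (by omega)
    have h2 := Nat.add_one_mul_choose_eq (3 * p + 2) p
    rw [show 3 * (p + 1) + 0 = 3 * p + 2 + 1 by ring] at h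
    have h' : (numHistTotal (d + (2 * p + 1)) d : ℚ) * (2 * (p + 1) + 0 + 1)
        = (0 + 1) * (3 * p + 2 + 1).choose (p + 1) := by exact_mod_cast h
    have h2' : ((3 * p + 2 + 1 : ℚ)) * (3 * p + 2).choose p
        = (3 * p + 2 + 1).choose (p + 1) * (p + 1) := by exact_mod_cast h2
    rw [div_mul_eq_mul_div, eq_div_iff hm]
    have hp : ((p : ℚ) + 1) ≠ 0 := by positivity
    apply mul_left_cancel₀ hp
    push_cast
    linear_combination ((p : ℚ) + 1) * h' - h2'
end

section
/- If a vector (a_1, ..., a_m) is the Tukey depth histogram of a point set in general position in R^d, then for every i ≤ m both (a_1, ..., a_{i-1}, a_i) and (a_1, ..., a_{i-1}, 1) are also depth histograms of point sets in general position in R^d. -/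
open scoped RealInnerProductSpace

/-- The Tukey depth of a point `p` with respect to a finite point set `P` in `ℝ^d`:
the minimum number of points of `P` contained in a closed halfspace containing `p`. -/
noncomputable def tukeyDepth {d : ℕ} (P : Finset (EuclideanSpace ℝ (Fin d)))
    (p : EuclideanSpace ℝ (Fin d)) : ℕ :=
  sInf {n : ℕ | ∃ v : EuclideanSpace ℝ (Fin d), v ≠ 0 ∧ ∃ c : ℝ,
    ⟪v, p⟫ ≤ c ∧ (P.filter fun x => ⟪v, x⟫ ≤ c).card = n}

/-- A finite point set in `ℝ^d` is in general position if no `d+1` of its points lie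
on a common hyperplane, i.e. every `(d+1)`-subset is affinely independent. -/
def GenPos {d : ℕ} (P : Finset (EuclideanSpace ℝ (Fin d))) : Prop :=
  ∀ S : Finset (EuclideanSpace ℝ (Fin d)), S ⊆ P → S.card = d + 1 →
    AffineIndependent ℝ (fun x : {x // x ∈ S} => (x : EuclideanSpace ℝ (Fin d)))


/-- The `i`-th entry of the Tukey depth histogram of `P`: the number of points of `P`
of Tukey depth exactly `i`. -/
noncomputable def depthHistogram {d : ℕ} (P : Finset (EuclideanSpace ℝ (Fin d))) (i : ℕ) : ℕ :=
  (P.filter fun p => tukeyDepth P p = i).card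


open Filter Topology

namespace TukeyAux

abbrev E (d : ℕ) := EuclideanSpace ℝ (Fin d)

/-- number of points of `R` in the halfspace with normal `v` through `y` -/
noncomputable def cnt {d : ℕ} (R : Finset (E d)) (v y : E d) : ℕ :=
  (R.filter fun x => ⟪v, x⟫ ≤ ⟪v, y⟫).card

/-- every halfspace through `y` has at least `k` points of `R` -/
def DGE {d : ℕ} (R : Finset (E d)) (y : E d) (k : ℕ) : Prop :=
  ∀ v : E d, v ≠ 0 → k ≤ cnt R v y

lemma DGE.mono {d : ℕ} {R : Finset (E d)} {y : E d} {k l : ℕ} (h : DGE R y k) (hl : l ≤ k) :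
    DGE R y l := fun v hv => hl.trans (h v hv)

lemma le_depth_iff {d : ℕ} [Nontrivial (E d)] (P : Finset (E d)) (p : E d) (k : ℕ) :
    k ≤ tukeyDepth P p ↔ DGE P p k := by
  obtain ⟨v0, hv0⟩ := exists_ne (0 : E d)
  constructor
  · intro h v hv
    refine h.trans (Nat.sInf_le ⟨v, hv, ⟪v, p⟫, le_rfl, rfl⟩)
  · intro h
    refine le_csInf ⟨_, v0, hv0, ⟪v0, p⟫, le_rfl, rfl⟩ ?_
    rintro n ⟨v, hv, c, hc, rfl⟩
    refine (h v hv).trans (Finset.card_le_card ?_)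
    intro x hx
    simp only [Finset.mem_filter] at hx ⊢
    exact ⟨hx.1, hx.2.trans hc⟩

lemma dge_depth {d : ℕ} [Nontrivial (E d)] (P : Finset (E d)) (p : E d) :
    DGE P p (tukeyDepth P p) := (le_depth_iff P p _).1 le_rfl

lemma exists_depth {d : ℕ} [Nontrivial (E d)] (P : Finset (E d)) (p : E d) :
    ∃ v : E d, v ≠ 0 ∧ cnt P v p = tukeyDepth P p := by
  by_contra! h
  have : tukeyDepth P p + 1 ≤ tukeyDepth P p := by
    rw [le_depth_iff]
    intro v hv
    have h1 := dge_depth P p v hv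
    have h2 := h v hv
    omega
  omega

lemma depth_pos {d : ℕ} [Nontrivial (E d)] {P : Finset (E d)} {p : E d} (hp : p ∈ P) :
    1 ≤ tukeyDepth P p := by
  rw [le_depth_iff]
  intro v hv
  exact Finset.card_pos.2 ⟨p, by simp [hp]⟩

/-- tilting a halfspace -/
lemma tilt {d : ℕ} (R : Finset (E d)) (v w z : E d) (hv : v ≠ 0) :
    ∃ v' : E d, v' ≠ 0 ∧ ∀ r ∈ R, (⟪v, z⟫ < ⟪v, r⟫ ∨ (⟪v, z⟫ = ⟪v, r⟫ ∧ ⟪w, z⟫ < ⟪w, r⟫)) →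
      ⟪v', z⟫ < ⟪v', r⟫ := by
  have h0 : ∀ᶠ ε : ℝ in 𝓝[>] 0, v + ε • w ≠ 0 := by
    have : Tendsto (fun ε : ℝ => v + ε • w) (𝓝[>] 0) (𝓝 v) := by
      have : Continuous (fun ε : ℝ => v + ε • w) := by fun_prop
      have := this.tendsto 0
      simp only [zero_smul, add_zero] at this
      exact this.mono_left nhdsWithin_le_nhds
    exact this.eventually_ne hv
  have h1 : ∀ᶠ ε : ℝ in 𝓝[>] 0, ∀ r ∈ R, (⟪v, z⟫ < ⟪v, r⟫ ∨ (⟪v, z⟫ = ⟪v, r⟫ ∧ ⟪w, z⟫ < ⟪w, r⟫)) →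
      ⟪v + ε • w, z⟫ < ⟪v + ε • w, r⟫ := by
    rw [Filter.eventually_all_finset]
    intro r hr
    by_cases h : ⟪v, z⟫ < ⟪v, r⟫
    · have c1 : Continuous (fun ε : ℝ => ⟪v + ε • w, r⟫ - ⟪v + ε • w, z⟫) := by fun_prop
      have := c1.tendsto 0
      simp only [zero_smul, add_zero] at this
      have := (this.mono_left (nhdsWithin_le_nhds (s := Set.Ioi 0))).eventually_const_lt (sub_pos.2 h)
      filter_upwards [this] with ε hε _
      linarith
    · filter_upwards [self_mem_nhdsWithin] with ε hε h'
      rcases h' with h' | ⟨h1, h2⟩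
      · exact absurd h' h
      · simp only [inner_add_left, inner_smul_left, h1]
        simp only [Set.mem_Ioi] at hε
        have := mul_lt_mul_of_pos_left h2 hε
        simpa using this
  obtain ⟨ε, h2, h3⟩ := (h0.and h1).exists
  exact ⟨_, h2, h3⟩

/-- the two-point lemma -/
lemma two_point {d : ℕ} (P : Finset (E d)) (x y v : E d) (hy : y ∈ P) (hxy : x ≠ y) (hv : v ≠ 0)
    (h : ⟪v, x⟫ ≤ ⟪v, y⟫) : ∃ v' : E d, v' ≠ 0 ∧ cnt P v' x + 1 ≤ cnt P v y := by
  obtain ⟨v', hv', H⟩ := tilt P v (y - x) x hv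
  refine ⟨v', hv', Finset.card_lt_card ?_⟩
  rw [Finset.ssubset_iff_of_subset]
  · refine ⟨y, by simp [hy], ?_⟩
    simp only [Finset.mem_filter, not_and, not_le]
    intro _
    apply H y hy
    rcases h.lt_or_eq with h | h
    · exact Or.inl h
    · refine Or.inr ⟨h, ?_⟩
      have : 0 < ⟪y - x, y - x⟫ := real_inner_self_pos.2 (sub_ne_zero.2 hxy.symm)
      rw [inner_sub_right] at this
      linarith
  · intro r hr
    simp only [Finset.mem_filter] at hr ⊢
    refine ⟨hr.1, ?_⟩
    by_contra! hc
    exact absurd (H r hr.1 (Or.inl (h.trans_lt hc))) (not_lt.2 hr.2)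

lemma dge_two_point {d : ℕ} {P : Finset (E d)} {x y v : E d} {k : ℕ} (hk : DGE P x k)
    (hy : y ∈ P) (hxy : x ≠ y) (hv : v ≠ 0) (h : ⟪v, x⟫ ≤ ⟪v, y⟫) : k + 1 ≤ cnt P v y := by
  obtain ⟨v', hv', H⟩ := two_point P x y v hy hxy hv h
  have := hk v' hv'
  omega

lemma cnt_mono {d : ℕ} {P Q : Finset (E d)} (h : P ⊆ Q) (v y : E d) : cnt P v y ≤ cnt Q v y :=
  Finset.card_le_card (Finset.filter_subset_filter _ h)

lemma depth_mono {d : ℕ} [Nontrivial (E d)] {P Q : Finset (E d)} (h : P ⊆ Q) (y : E d) :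
    tukeyDepth P y ≤ tukeyDepth Q y := by
  rw [le_depth_iff]
  intro v hv
  exact (dge_depth P y v hv).trans (cnt_mono h v y)

lemma cnt_insert_of_le {d : ℕ} {R : Finset (E d)} {x v y : E d} (hx : x ∉ R)
    (h : ⟪v, x⟫ ≤ ⟪v, y⟫) : cnt (insert x R) v y = cnt R v y + 1 := by
  unfold cnt
  rw [Finset.filter_insert, if_pos h, Finset.card_insert_of_notMem (by simp [hx])]

lemma cnt_insert_of_lt {d : ℕ} {R : Finset (E d)} {x v y : E d}
    (h : ⟪v, y⟫ < ⟪v, x⟫) : cnt (insert x R) v y = cnt R v y := by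
  unfold cnt
  rw [Finset.filter_insert, if_neg (not_le.2 h)]

/-- removing a point of at least the depth of `p` does not change the depth of `p` -/
lemma depth_insert {d : ℕ} [Nontrivial (E d)] {R : Finset (E d)} {q p : E d} (hq : q ∉ R)
    (hp : p ∈ R) (h : tukeyDepth (insert q R) p ≤ tukeyDepth (insert q R) q) :
    tukeyDepth R p = tukeyDepth (insert q R) p := by
  apply le_antisymm (depth_mono (Finset.subset_insert _ _) _)
  rw [le_depth_iff]
  intro v hv
  by_cases hc : ⟪v, q⟫ ≤ ⟪v, p⟫
  · have h1 := cnt_insert_of_le hq hc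
    have := dge_two_point ((dge_depth (insert q R) q).mono h) (Finset.mem_insert_of_mem hp)
      (by rintro rfl; exact hq hp) hv hc
    omega
  · rw [← cnt_insert_of_lt (R := R) (not_le.1 hc)]
    exact dge_depth _ _ v hv

lemma depth_down {d : ℕ} [Nontrivial (E d)] (Q : Finset (E d)) (n : ℕ) :
    ∀ P : Finset (E d), Q ⊆ P → (P \ Q).card = n →
      (∀ p ∈ Q, ∀ r ∈ P \ Q, tukeyDepth P p ≤ tukeyDepth P r) →
      ∀ p ∈ Q, tukeyDepth Q p = tukeyDepth P p := by
  classical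
  induction n with
  | zero =>
    intro P hQ hc _ p hp
    rw [Finset.card_eq_zero, Finset.sdiff_eq_empty_iff_subset] at hc
    rw [Finset.Subset.antisymm hQ hc]
  | succ n ih =>
    intro P hQ hc hd p hp
    obtain ⟨r, hr, hmax⟩ := Finset.exists_max_image (P \ Q) (tukeyDepth P)
      (Finset.card_pos.1 (by omega))
    have hr' := Finset.mem_sdiff.1 hr
    have hall : ∀ x ∈ P, tukeyDepth P x ≤ tukeyDepth P r := by
      intro x hx
      by_cases hxQ : x ∈ Q
      · exact hd x hxQ r hr
      · exact hmax x (Finset.mem_sdiff.2 ⟨hx, hxQ⟩)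
    have hins : insert r (P.erase r) = P := Finset.insert_erase hr'.1
    have key : ∀ x ∈ P.erase r, tukeyDepth (P.erase r) x = tukeyDepth P x := by
      intro x hx
      have := depth_insert (Finset.notMem_erase r P) hx
        (by rw [hins]; exact hall x (Finset.mem_of_mem_erase hx))
      rwa [hins] at this
    have hQ' : Q ⊆ P.erase r := fun x hx =>
      Finset.mem_erase.2 ⟨by rintro rfl; exact hr'.2 hx, hQ hx⟩
    have hsd : P.erase r \ Q = (P \ Q).erase r := by
      ext x; simp only [Finset.mem_sdiff, Finset.mem_erase]; tauto
    rw [← key p (hQ' hp)]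
    apply ih (P.erase r) hQ' ?_ ?_ p hp
    · rw [hsd, Finset.card_erase_of_mem hr]; omega
    · intro a ha b hb
      rw [key a (hQ' ha), key b (Finset.mem_sdiff.1 hb).1]
      rw [hsd] at hb
      exact hd a ha b (Finset.mem_of_mem_erase hb)

lemma depth_down' {d : ℕ} [Nontrivial (E d)] {P Q : Finset (E d)} (h : Q ⊆ P)
    (hd : ∀ p ∈ Q, ∀ r ∈ P, r ∉ Q → tukeyDepth P p ≤ tukeyDepth P r) {p : E d} (hp : p ∈ Q) :
    tukeyDepth Q p = tukeyDepth P p := by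
  classical
  exact depth_down Q _ P h rfl
    (fun p hp r hr => hd p hp r (Finset.mem_sdiff.1 hr).1 (Finset.mem_sdiff.1 hr).2) p hp

lemma not_dge_eventually {d : ℕ} {R : Finset (E d)} {z : E d} {k : ℕ} (h : ¬ DGE R z k) :
    ∀ᶠ y in 𝓝 z, ¬ DGE R y k := by
  unfold DGE at h
  push Not at h
  obtain ⟨v, hv, h⟩ := h
  have h1 : ∀ᶠ y in 𝓝 z, ∀ r ∈ R, ⟪v, z⟫ < ⟪v, r⟫ → ⟪v, y⟫ < ⟪v, r⟫ := by
    rw [Filter.eventually_all_finset]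
    intro r hr
    by_cases hlt : ⟪v, z⟫ < ⟪v, r⟫
    · have c : Continuous fun y : E d => ⟪v, y⟫ := by fun_prop
      filter_upwards [(c.tendsto z).eventually_lt_const hlt] with y hy _
      exact hy
    · exact Eventually.of_forall fun y hy => absurd hy hlt
  filter_upwards [h1] with y hy hD
  have h2 := hD v hv
  have h3 : cnt R v y ≤ cnt R v z := by
    apply Finset.card_le_card
    intro r hr
    simp only [Finset.mem_filter] at hr ⊢
    refine ⟨hr.1, ?_⟩
    by_contra! hc
    exact absurd (hy r hr.1 hc) (not_lt.2 hr.2)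
  omega

lemma dge_eventually {d : ℕ} {R : Finset (E d)} {z : E d} {k : ℕ}
    (h : ∀ v : E d, v ≠ 0 → k ≤ (R.filter fun r => ⟪v, r⟫ < ⟪v, z⟫).card) :
    ∀ᶠ y in 𝓝 z, DGE R y k := by
  have h1 : ∀ᶠ y in 𝓝 z, ∀ v ∈ Metric.sphere (0 : E d) 1, k ≤ cnt R v y := by
    apply (isCompact_sphere (0 : E d) 1).eventually_forall_of_forall_eventually
    intro v hv
    have hv0 : v ≠ 0 := by
      rintro rfl
      simp at hv
    have h2 : ∀ᶠ q : E d × E d in 𝓝 (z, v), ∀ r ∈ R, ⟪v, r⟫ < ⟪v, z⟫ → ⟪q.2, r⟫ < ⟪q.2, q.1⟫ := by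
      rw [Filter.eventually_all_finset]
      intro r hr
      by_cases hlt : ⟪v, r⟫ < ⟪v, z⟫
      · have c : Continuous fun q : E d × E d => ⟪q.2, q.1⟫ - ⟪q.2, r⟫ := by fun_prop
        filter_upwards [(c.tendsto (z, v)).eventually_const_lt (sub_pos.2 hlt)] with q hq _
        linarith
      · exact Eventually.of_forall fun y hy => absurd hy hlt
    filter_upwards [h2] with q hq
    refine (h v hv0).trans (Finset.card_le_card ?_)
    intro r hr
    simp only [Finset.mem_filter] at hr ⊢
    exact ⟨hr.1, (hq r hr.1 hr.2).le⟩
  filter_upwards [h1] with y hy v hv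
  have hn : 0 < ‖v‖ := norm_pos_iff.2 hv
  have := hy (‖v‖⁻¹ • v) (by simp [norm_smul, hn.ne'])
  refine this.trans (Finset.card_le_card ?_)
  intro r hr
  simp only [Finset.mem_filter, inner_smul_left] at hr ⊢
  refine ⟨hr.1, ?_⟩
  have h5 := hr.2
  simp only [conj_trivial] at h5
  exact le_of_mul_le_mul_left h5 (inv_pos.2 hn)

lemma exists_tilt {d : ℕ} {R : Finset (E d)} {v z : E d} (hv : v ≠ 0) (U : Finset (E d))
    (h : z ∉ convexHull ℝ ((R.filter fun r => ⟪v, r⟫ = ⟪v, z⟫ ∧ r ∉ U : Finset (E d)) : Set (E d))) :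
    ∃ v' : E d, v' ≠ 0 ∧ cnt R v' z ≤ (R.filter fun r => ⟪v, r⟫ < ⟪v, z⟫).card + U.card := by
  classical
  obtain ⟨f, u, hu1, hu2⟩ := geometric_hahn_banach_point_closed (convex_convexHull ℝ _)
    (Set.Finite.isCompact_convexHull (𝕜 := ℝ) (Finset.finite_toSet _)).isClosed h
  obtain ⟨w, rfl⟩ := (InnerProductSpace.toDual ℝ (E d)).surjective f
  simp only [InnerProductSpace.toDual_apply_apply] at hu1 hu2
  obtain ⟨v', hv', H⟩ := tilt R v w z hv
  refine ⟨v', hv', (Finset.card_le_card ?_).trans (Finset.card_union_le _ _)⟩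
  intro r hr
  simp only [Finset.mem_filter, Finset.mem_union] at hr ⊢
  by_contra! hc
  have h1 := hc.1 hr.1
  refine absurd hr.2 (not_le.2 (H r hr.1 ?_))
  rcases h1.lt_or_eq with h1 | h1
  · exact Or.inl h1
  · refine Or.inr ⟨h1, hu1.trans (hu2 r (subset_convexHull ℝ _ ?_))⟩
    simp only [Finset.coe_filter, Set.mem_ofPred_eq]
    exact ⟨hr.1, h1.symm, hc.2⟩

def AI {d : ℕ} (S : Finset (E d)) : Prop :=
  AffineIndependent ℝ (fun x : {x // x ∈ S} => (x : E d))

lemma AI.mono {d : ℕ} {S T : Finset (E d)} (h : AI T) (hST : S ⊆ T) : AI S := by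
  exact AffineIndependent.mono (s := (S : Set (E d))) (t := (T : Set (E d))) h hST

/-- fibres of `R` are affinely independent -/
def Fib {d : ℕ} (R : Finset (E d)) : Prop :=
  ∀ v : E d, v ≠ 0 → ∀ c : ℝ, AI (R.filter fun r => ⟪v, r⟫ = c)

lemma exists_notMem_hull {d : ℕ} {T : Finset (E d)} (hT : AI T) (z : E d) :
    ∃ U : Finset (E d), U.card ≤ 1 ∧ z ∉ convexHull ℝ ((T.filter fun r => r ∉ U : Finset (E d)) : Set (E d)) := by
  classical
  by_cases hz : z ∈ convexHull ℝ (T : Set (E d))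
  · have hne : (T.powerset.filter fun S : Finset (E d) => z ∈ convexHull ℝ (S : Set (E d))).Nonempty :=
      ⟨T, by simp [hz]⟩
    obtain ⟨S, hS, hmin⟩ := Finset.exists_min_image _ Finset.card hne
    simp only [Finset.mem_filter, Finset.mem_powerset] at hS hmin
    have hSne : S.Nonempty := by
      rw [Finset.nonempty_iff_ne_empty]
      rintro rfl
      simp at hS
    obtain ⟨t, ht⟩ := hSne
    refine ⟨{t}, by simp, fun hc => ?_⟩
    have hcap := AffineIndependent.convexHull_inter (R := ℝ) (s := T) hT hS.1
      (Finset.filter_subset (fun r => r ∉ ({t} : Finset (E d))) T)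
    have : z ∈ convexHull ℝ ((S ∩ (T.filter fun r => r ∉ ({t} : Finset (E d))) : Finset (E d)) : Set (E d)) := by
      rw [Finset.coe_inter, hcap]
      exact ⟨hS.2, hc⟩
    have h2 := hmin _ ⟨Finset.inter_subset_left.trans hS.1, this⟩
    have h3 : (S ∩ (T.filter fun r => r ∉ ({t} : Finset (E d)))).card < S.card := by
      apply Finset.card_lt_card
      rw [Finset.ssubset_iff_of_subset Finset.inter_subset_left]
      exact ⟨t, ht, by simp⟩
    omega
  · exact ⟨∅, by simp, by simpa using hz⟩

/-- jump lemma -/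
lemma dge_eventually_pred {d : ℕ} {R : Finset (E d)} (hR : Fib R) {z : E d} {j : ℕ}
    (h : DGE R z j) : ∀ᶠ y in 𝓝 z, DGE R y (j - 1) := by
  apply dge_eventually
  intro v hv
  obtain ⟨U, hU, hz⟩ := exists_notMem_hull (hR v hv ⟪v, z⟫) z
  rw [Finset.filter_filter] at hz
  obtain ⟨v', hv', H⟩ := exists_tilt hv U hz
  have := h v' hv'
  omega

lemma dge_eventually_self {d : ℕ} {R : Finset (E d)} {z : E d} (hR : Fib (insert z R)) (hz : z ∉ R)
    {j : ℕ} (h : DGE R z j) : ∀ᶠ y in 𝓝 z, DGE R y j := by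
  classical
  apply dge_eventually
  intro v hv
  have h1 := hR v hv ⟪v, z⟫
  have h2 : z ∉ convexHull ℝ ((R.filter fun r => ⟪v, r⟫ = ⟪v, z⟫ ∧ r ∉ (∅ : Finset (E d)) : Finset (E d)) : Set (E d)) := by
    intro hc
    have h3 := AffineIndependent.convexHull_inter (R := ℝ) h1
      (t₁ := {z}) (t₂ := R.filter fun r => ⟪v, r⟫ = ⟪v, z⟫ ∧ r ∉ (∅ : Finset (E d))) (by simp)
      (by intro r hr; simp at hr ⊢; tauto)
    have h4 : z ∈ convexHull ℝ ((({z} : Finset (E d)) : Set (E d)) ∩ ((R.filter fun r => ⟪v, r⟫ = ⟪v, z⟫ ∧ r ∉ (∅ : Finset (E d)) : Finset (E d)) : Set (E d))) := by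
      rw [h3]
      exact ⟨by simp, hc⟩
    rw [← Finset.coe_inter] at h4
    have : ({z} : Finset (E d)) ∩ (R.filter fun r => ⟪v, r⟫ = ⟪v, z⟫ ∧ r ∉ (∅ : Finset (E d))) = ∅ := by
      ext r
      simp only [Finset.mem_inter, Finset.mem_singleton, Finset.mem_filter, Finset.notMem_empty, iff_false, not_and]
      rintro rfl h
      exact absurd h hz
    rw [this] at h4
    simp at h4
  obtain ⟨v', hv', H⟩ := exists_tilt hv ∅ h2
  have := h v' hv'
  simp at H
  omega

/-- leaving the region of depth at least `j` along a ray -/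
lemma exists_leave {d : ℕ} {R : Finset (E d)} (hR : Fib R) {o w : E d} (hw : w ≠ 0) {j : ℕ}
    (hj : 1 ≤ j) (h : DGE R o j) :
    ∃ a : ℝ, 0 ≤ a ∧ DGE R (o + a • w) j ∧
      ∀ᶠ t in 𝓝[>] a, DGE R (o + t • w) (j - 1) ∧ ¬ DGE R (o + t • w) j := by
  have hcont : Continuous fun t : ℝ => o + t • w := by fun_prop
  set S : Set ℝ := {t | 0 ≤ t ∧ DGE R (o + t • w) j} with hS
  have hww : 0 < ⟪w, w⟫ := real_inner_self_pos.2 hw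
  have hclosed : IsClosed S := by
    rw [hS, Set.ofPred_and]
    refine (isClosed_le continuous_const continuous_id).inter ?_
    rw [← isOpen_compl_iff, isOpen_iff_mem_nhds]
    intro t ht
    exact (hcont.tendsto t).eventually (not_dge_eventually ht)
  have hbdd : BddAbove S := by
    obtain ⟨M, hM⟩ := (R.image fun r => ⟪w, r⟫).bddAbove
    refine ⟨(M - ⟪w, o⟫) / ⟪w, w⟫, ?_⟩
    rintro t ⟨_, ht⟩
    rw [le_div_iff₀ hww]
    have h1 := ht (-w) (neg_ne_zero.2 hw)
    obtain ⟨r, hr⟩ := Finset.card_pos.1 (lt_of_lt_of_le (by omega) h1)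
    simp only [Finset.mem_filter, inner_neg_left, inner_add_right, inner_smul_right] at hr
    have h2 : ⟪w, r⟫ ≤ M := hM (by simp only [Finset.coe_image]; exact ⟨r, hr.1, rfl⟩)
    linarith
  have hmem := hclosed.csSup_mem ⟨0, le_rfl, by simpa using h⟩ hbdd
  refine ⟨sSup S, hmem.1, hmem.2, ?_⟩
  have h1 := (hcont.tendsto (sSup S)).eventually (dge_eventually_pred hR hmem.2)
  filter_upwards [h1.filter_mono nhdsWithin_le_nhds, self_mem_nhdsWithin] with t ht1 ht2
  refine ⟨ht1, fun hc => ?_⟩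
  have : t ≤ sSup S := le_csSup hbdd ⟨hmem.1.trans (le_of_lt ht2), hc⟩
  exact absurd ht2 (not_lt.2 this)

/-- strong general position -/
def SGP {d : ℕ} (R : Finset (E d)) : Prop := ∀ S ⊆ R, S.card ≤ d + 1 → AI S

lemma SGP.mono {d : ℕ} {R Q : Finset (E d)} (h : SGP Q) (hR : R ⊆ Q) : SGP R :=
  fun S hS hc => h S (hS.trans hR) hc

lemma SGP.genPos {d : ℕ} {R : Finset (E d)} (h : SGP R) : GenPos R :=
  fun S hS hc => h S hS hc.le

lemma sgp_of_genPos {d : ℕ} {R : Finset (E d)} (h : GenPos R) (hc : d + 1 ≤ R.card) : SGP R := by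
  intro S hS hSc
  obtain ⟨T, hST, hTR, hT⟩ := Finset.exists_subsuperset_card_eq hS hSc hc
  exact AI.mono (h T hTR hT) hST

lemma SGP.card_fib {d : ℕ} {R : Finset (E d)} (h : SGP R) {v : E d} (hv : v ≠ 0) (c : ℝ) :
    (R.filter fun r => ⟪v, r⟫ = c).card ≤ d := by
  by_contra! hc
  obtain ⟨S, hS, hSc⟩ := Finset.exists_subset_card_eq hc
  have hAI := h S (hS.trans (Finset.filter_subset _ _)) hSc.le
  have htop : affineSpan ℝ (Set.range fun x : {x // x ∈ S} => (x : E d)) = ⊤ := by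
    rw [AffineIndependent.affineSpan_eq_top_iff_card_eq_finrank_add_one hAI]
    simp [hSc]
  obtain ⟨s, hs⟩ : S.Nonempty := Finset.card_pos.1 (by omega)
  have hdir : Submodule.span ℝ {v} ≤ ⊥ := by
    have h2 := AffineSubspace.vectorSpan_eq_top_of_affineSpan_eq_top ℝ (E d) (E d) htop
    have h3 : vectorSpan ℝ (Set.range fun x : {x // x ∈ S} => (x : E d)) ≤ (Submodule.span ℝ {v})ᗮ := by
      rw [vectorSpan, Submodule.span_le]
      rintro _ ⟨_, ⟨a, rfl⟩, _, ⟨b, rfl⟩, rfl⟩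
      simp only [vsub_eq_sub, SetLike.mem_coe]
      rw [Submodule.mem_orthogonal_singleton_iff_inner_right]
      have ha := (Finset.mem_filter.1 (hS a.2)).2
      have hb := (Finset.mem_filter.1 (hS b.2)).2
      rw [inner_sub_right, ha, hb, sub_self]
    rw [h2, top_le_iff, Submodule.orthogonal_eq_top_iff] at h3
    exact h3.le
  have : v ∈ (⊥ : Submodule ℝ (E d)) := hdir (Submodule.mem_span_singleton_self v)
  exact hv (by simpa using this)

lemma SGP.fib {d : ℕ} {R : Finset (E d)} (h : SGP R) : Fib R := by
  intro v hv c
  exact h _ (Finset.filter_subset _ _) ((h.card_fib hv c).trans (by omega))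

lemma sgp_notMem {d : ℕ} {R : Finset (E d)} {q : E d} (h : SGP (insert q R)) (hq : q ∉ R)
    {S : Finset (E d)} (hS : S ⊆ R) (hc : S.card ≤ d) : q ∉ affineSpan ℝ (S : Set (E d)) := by
  have hqS : q ∉ S := fun hh => hq (hS hh)
  have hAI := h (insert q S) (Finset.insert_subset_insert _ hS)
    (by rw [Finset.card_insert_of_notMem hqS]; omega)
  have := AffineIndependent.notMem_affineSpan_sdiff hAI ⟨q, by simp⟩ Set.univ
  intro hc
  apply this
  convert hc using 2
  ext x
  simp only [Set.mem_image, Set.mem_sdiff, Set.mem_univ, true_and, Set.mem_singleton_iff, Subtype.exists,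
    Finset.mem_insert, Subtype.mk.injEq, Finset.mem_coe]
  constructor
  · rintro ⟨a, h1 | h1, h2, rfl⟩
    · exact absurd h1 h2
    · exact h1
  · intro hx
    exact ⟨x, Or.inr hx, by rintro rfl; exact hqS hx, rfl⟩

lemma sgp_insert {d : ℕ} {R : Finset (E d)} {x : E d} (h : SGP R)
    (hx : ∀ S ⊆ R, S.card ≤ d → x ∉ affineSpan ℝ (S : Set (E d))) : SGP (insert x R) := by
  classical
  intro S hS hc
  by_cases hxS : x ∈ S
  · have hsub : S.erase x ⊆ R := by
      intro y hy
      have := hS (Finset.mem_of_mem_erase hy)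
      exact Finset.mem_of_mem_insert_of_ne this (Finset.ne_of_mem_erase hy)
    have hcard : (S.erase x).card ≤ d := by
      rw [Finset.card_erase_of_mem hxS]; omega
    have h1 := h _ hsub (by omega)
    have h2 := hx _ hsub hcard
    refine AffineIndependent.affineIndependent_of_notMem_span
      (p := fun y : {y // y ∈ S} => (y : E d)) (i := (⟨x, hxS⟩ : {y // y ∈ S})) ?_ ?_
    · let e : {y : {y // y ∈ S} // y ≠ ⟨x, hxS⟩} ↪ {y // y ∈ S.erase x} :=
        ⟨fun y => ⟨y.1.1, Finset.mem_erase.2 ⟨fun hh => y.2 (Subtype.ext hh), y.1.2⟩⟩,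
          fun a b hab => Subtype.ext (Subtype.ext (congrArg (fun z => z.1) hab))⟩
      have h1' : AffineIndependent ℝ (fun y : {y // y ∈ S.erase x} => (y : E d)) := h1
      have h1'' := AffineIndependent.comp_embedding e h1'
      exact h1''
    · intro hmem
      apply h2
      have hs : ((fun y : {y // y ∈ S} => (y : E d)) '' {y | y ≠ ⟨x, hxS⟩}) ⊆
          ((S.erase x : Finset (E d)) : Set (E d)) := by
        rintro _ ⟨y, hy, rfl⟩
        simp only [Finset.coe_erase, Set.mem_sdiff, Finset.mem_coe, Set.mem_singleton_iff]
        exact ⟨y.2, fun hh => hy (Subtype.ext hh)⟩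
      exact (affineSpan_mono ℝ hs) hmem
  · apply h S _ hc
    intro y hy
    exact Finset.mem_of_mem_insert_of_ne (hS hy) (by rintro rfl; exact hxS hy)

lemma eventually_notMem_span {d : ℕ} {o : E d} (w : E d) {A : AffineSubspace ℝ (E d)} (ho : o ∉ A)
    (a : ℝ) : ∀ᶠ t in 𝓝[>] a, o + t • w ∉ A := by
  have hsub : {t : ℝ | o + t • w ∈ A}.Subsingleton := by
    intro t ht s hs
    by_contra hne
    apply ho
    have h1 := AffineMap.lineMap_mem (t / (t - s)) ht hs
    have h2 : t - s ≠ 0 := sub_ne_zero.2 hne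
    convert h1 using 1
    rw [AffineMap.lineMap_apply]
    simp only [vsub_eq_sub, vadd_eq_add, add_sub_add_left_eq_sub, ← sub_smul, smul_smul]
    have : t / (t - s) * (s - t) = - t := by field_simp; ring
    rw [this, neg_smul]
    abel
  rcases hsub.eq_empty_or_singleton with h | ⟨t0, h⟩
  · refine Eventually.of_forall fun t ht => ?_
    have : t ∈ {t : ℝ | o + t • w ∈ A} := ht
    rw [h] at this
    exact this
  · have : ∀ᶠ t in 𝓝[>] a, t ≠ t0 := by
      by_cases hh : t0 = a
      · subst hh
        filter_upwards [self_mem_nhdsWithin] with t ht using (ne_of_gt ht)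
      · have := (continuous_id (X := ℝ)).tendsto a |>.eventually_ne (Ne.symm hh)
        exact this.filter_mono nhdsWithin_le_nhds
    filter_upwards [this] with t ht hc
    have : t ∈ {t : ℝ | o + t • w ∈ A} := hc
    rw [h] at this
    exact ht this

/-- directions for the planar construction -/
noncomputable def u (l : ℕ) : E 2 := !₂[(-1 : ℝ) ^ l, (-1 : ℝ) ^ l * l]

lemma inner_u (v : E 2) (l : ℕ) : ⟪v, u l⟫ = (-1 : ℝ) ^ l * (v 0 + v 1 * l) := by
  simp [u, PiLp.inner_apply, Fin.sum_univ_two]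
  ring

lemma u_npar {s c : ℝ} (hs : s ≠ 0) {N l : ℕ} (h : s • u N = c • u l) : N = l := by
  have h0 := congrArg (fun x : E 2 => x 0) h
  have h1 := congrArg (fun x : E 2 => x 1) h
  simp [u] at h0 h1
  have h2 : s * (-1 : ℝ) ^ N * ((N : ℝ) - l) = 0 := by linear_combination h1 - (l : ℝ) * h0
  have h3 : s * (-1 : ℝ) ^ N ≠ 0 := mul_ne_zero hs (pow_ne_zero _ (by norm_num))
  have h4 := (mul_eq_zero.1 h2).resolve_left h3
  exact_mod_cast sub_eq_zero.1 h4

lemma u_ne_zero (N : ℕ) : u N ≠ 0 := by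
  intro h
  have h0 := congrArg (fun x : E 2 => x 0) h
  simp [u] at h0

lemma smul_u_ne_zero {s : ℝ} (hs : s ≠ 0) (N : ℕ) : s • u N ≠ 0 := smul_ne_zero hs (u_ne_zero N)

lemma count_pairs (v : E 2) (s : ℕ) :
    s ≤ ((Finset.range (2 * s)).filter fun l => ⟪v, u l⟫ ≤ 0).card ∨
    (s ≤ ((Finset.range (2 * s)).filter fun l => ⟪v, u l⟫ ≤ 0).card + 1 ∧ v 1 < 0 ∧
      v 0 + v 1 * ((2 * s : ℕ) : ℝ) < 0) := by
  induction s with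
  | zero => left; simp
  | succ s ih =>
    have e1 : ⟪v, u (2 * s)⟫ = v 0 + v 1 * ((2 * s : ℕ) : ℝ) := by
      rw [inner_u]; simp [pow_mul]
    have e2 : ⟪v, u (2 * s + 1)⟫ = - (v 0 + v 1 * ((2 * s + 1 : ℕ) : ℝ)) := by
      rw [inner_u]; simp [pow_mul, pow_succ]
    have hc : ((Finset.range (2 * (s + 1))).filter fun l => ⟪v, u l⟫ ≤ 0).card =
        ((Finset.range (2 * s)).filter fun l => ⟪v, u l⟫ ≤ 0).card +
        (if ⟪v, u (2 * s)⟫ ≤ 0 then 1 else 0) + (if ⟪v, u (2 * s + 1)⟫ ≤ 0 then 1 else 0) := by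
      simp only [Finset.card_filter, mul_add, mul_one]
      rw [Finset.sum_range_succ, Finset.sum_range_succ]
    rw [hc, e1, e2]
    push_cast at ih ⊢
    rcases ih with h | ⟨h, hb, hn⟩
    · by_cases h1 : v 0 + v 1 * (2 * (s : ℝ)) ≤ 0
      · left; rw [if_pos h1]; omega
      · by_cases h2 : -(v 0 + v 1 * (2 * (s : ℝ) + 1)) ≤ 0
        · left; rw [if_pos h2]; omega
        · right
          push Not at h1 h2
          have hb : v 1 < 0 := by nlinarith
          exact ⟨by omega, hb, by nlinarith⟩
    · right
      rw [if_pos hn.le]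
      refine ⟨by omega, hb, by nlinarith⟩

lemma count_u (v : E 2) (N : ℕ) :
    (N - 1) / 2 ≤ ((Finset.range N).filter fun l => ⟪v, u l⟫ ≤ 0).card := by
  rcases Nat.even_or_odd' N with ⟨s, rfl | rfl⟩
  · rcases count_pairs v s with h | ⟨h, _⟩ <;> omega
  · have e1 : ⟪v, u (2 * s)⟫ = v 0 + v 1 * ((2 * s : ℕ) : ℝ) := by
      rw [inner_u]; simp [pow_mul]
    have hc : ((Finset.range (2 * s + 1)).filter fun l => ⟪v, u l⟫ ≤ 0).card =
        ((Finset.range (2 * s)).filter fun l => ⟪v, u l⟫ ≤ 0).card +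
        (if ⟪v, u (2 * s)⟫ ≤ 0 then 1 else 0) := by
      simp only [Finset.card_filter]
      rw [Finset.sum_range_succ]
    rw [hc, e1]
    rcases count_pairs v s with h | ⟨h, hb, hn⟩
    · omega
    · rw [if_pos hn.le]; omega

noncomputable def RN (t : ℕ → ℝ) (N : ℕ) : Finset (E 2) :=
  (Finset.range N).image fun l => t l • u l

lemma mem_RN {t : ℕ → ℝ} {N : ℕ} {p : E 2} : p ∈ RN t N ↔ ∃ l < N, t l • u l = p := by
  simp [RN]

lemma RN_injOn {t : ℕ → ℝ} {N : ℕ} (ht : ∀ l < N, 0 < t l) :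
    Set.InjOn (fun l => t l • u l) (Finset.range N : Set ℕ) := by
  intro a ha b hb hab
  simp only [Finset.coe_range, Set.mem_Iio] at ha hb
  exact u_npar (ht a ha).ne' hab

lemma RN_card {t : ℕ → ℝ} {N : ℕ} (ht : ∀ l < N, 0 < t l) : (RN t N).card = N := by
  rw [RN, Finset.card_image_of_injOn (RN_injOn ht), Finset.card_range]

lemma RN_dge {t : ℕ → ℝ} {N : ℕ} (ht : ∀ l < N, 0 < t l) : DGE (RN t N) 0 ((N - 1) / 2) := by
  intro v hv
  refine (count_u v N).trans ?_
  unfold cnt RN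
  rw [Finset.filter_image, Finset.card_image_of_injOn]
  · apply Finset.card_le_card
    intro l hl
    simp only [Finset.mem_filter, Finset.mem_range, inner_smul_right, inner_zero_right] at hl ⊢
    exact ⟨hl.1, mul_nonpos_of_nonneg_of_nonpos (ht l hl.1).le hl.2⟩
  · exact (RN_injOn ht).mono (by intro l hl; simp at hl ⊢; exact hl.1)

instance : Nontrivial (E 2) := ⟨⟨u 0, 0, u_ne_zero 0⟩⟩

lemma planar_depth_le {Q : Finset (E 2)} (hQ : SGP Q) {p : E 2} (hp : p ∈ Q) (hc : 2 ≤ Q.card) :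
    2 * tukeyDepth Q p ≤ Q.card := by
  obtain ⟨r, hr, hne⟩ := Finset.exists_mem_ne (show 1 < Q.card by omega) p
  set v : E 2 := !₂[-(r 1 - p 1), r 0 - p 0] with hv
  have hv0 : v ≠ 0 := by
    intro h
    have h0 := congrArg (fun x : E 2 => x 0) h
    have h1 := congrArg (fun x : E 2 => x 1) h
    simp [hv] at h0 h1
    apply hne
    ext i
    fin_cases i
    · simp; linarith
    · simp; linarith
  have hvr : ⟪v, p⟫ = ⟪v, r⟫ := by
    simp [hv, PiLp.inner_apply, Fin.sum_univ_two]
    ring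
  have h1 := dge_two_point (dge_depth Q p) hr hne.symm hv0 hvr.le
  have h2 := dge_two_point (dge_depth Q p) hr hne.symm (neg_ne_zero.2 hv0)
    (by simp [hvr])
  have h3 := hQ.card_fib hv0 ⟪v, r⟫
  have h4 : cnt Q v r + cnt Q (-v) r = Q.card + (Q.filter fun x => ⟪v, x⟫ = ⟪v, r⟫).card := by
    unfold cnt
    simp only [inner_neg_left, neg_le_neg_iff]
    rw [← Finset.card_union_add_card_inter, ← Finset.filter_or, ← Finset.filter_and]
    congr 2
    · apply Finset.filter_true_of_mem
      intro x _
      exact le_total _ _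
    · ext x
      simp only [Finset.mem_filter, le_antisymm_iff]
  omega

lemma planar_sgp {t : ℕ → ℝ} {N : ℕ} (ht : ∀ l < N, 0 < t l) (h : SGP (insert 0 (RN t N)))
    {a : ℝ} (ha : 0 ≤ a) : ∀ᶠ s in 𝓝[>] a, SGP (insert 0 (insert (s • u N) (RN t N))) := by
  have h0 : (0 : E 2) ∉ RN t N := by
    rw [mem_RN]
    rintro ⟨l, hl, h⟩
    exact smul_u_ne_zero (ht l hl).ne' l h
  have key : ∀ᶠ s in 𝓝[>] a, ∀ S ∈ (insert 0 (RN t N)).powerset, S.card ≤ 2 →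
      s • u N ∉ affineSpan ℝ (S : Set (E 2)) := by
    rw [Filter.eventually_all_finset]
    intro S hS
    rw [Finset.mem_powerset] at hS
    by_cases hc : S.card ≤ 2
    swap
    · exact Eventually.of_forall fun s hh => absurd hh hc
    by_cases h0S : (0 : E 2) ∈ S
    · filter_upwards [self_mem_nhdsWithin] with s hs _ hmem
      have hs0 : s ≠ 0 := (ha.trans_lt hs).ne'
      have hl : ∃ l, l ≠ N ∧ ∀ y ∈ S, ∃ c : ℝ, c • u l = y := by
        have hce : (S.erase 0).card ≤ 1 := by
          rw [Finset.card_erase_of_mem h0S]; omega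
        rcases (S.erase 0).eq_empty_or_nonempty with he | ⟨r, hr⟩
        · refine ⟨N + 1, by omega, fun y hy => ⟨0, ?_⟩⟩
          by_contra hne
          have : y ∈ S.erase 0 := Finset.mem_erase.2 ⟨by rintro rfl; simp at hne, hy⟩
          rw [he] at this
          simp at this
        · have hr' := Finset.mem_erase.1 hr
          obtain ⟨l, hl, hlr⟩ := mem_RN.1 (Finset.mem_of_mem_insert_of_ne (hS hr'.2) hr'.1)
          refine ⟨l, by omega, fun y hy => ?_⟩
          by_cases hy0 : y = 0
          · exact ⟨0, by simp [hy0]⟩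
          · have : y = r := Finset.card_le_one.1 hce _ (Finset.mem_erase.2 ⟨hy0, hy⟩) _ hr
            exact ⟨t l, by rw [this, hlr]⟩
      obtain ⟨l, hlN, hl⟩ := hl
      have hle : affineSpan ℝ (S : Set (E 2)) ≤ (Submodule.span ℝ {u l}).toAffineSubspace := by
        rw [affineSpan_le]
        intro y hy
        obtain ⟨c, rfl⟩ := hl y hy
        exact Submodule.smul_mem _ _ (Submodule.mem_span_singleton_self _)
      have := hle hmem
      rw [Submodule.mem_toAffineSubspace, Submodule.mem_span_singleton] at this
      obtain ⟨c, hc⟩ := this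
      exact hlN (u_npar hs0 hc.symm).symm
    · have hSR : S ⊆ RN t N := fun y hy =>
        Finset.mem_of_mem_insert_of_ne (hS hy) (by rintro rfl; exact h0S hy)
      have := eventually_notMem_span (u N) (sgp_notMem h h0 hSR hc) a
      filter_upwards [this] with s hs _
      simpa using hs
  filter_upwards [key] with s hs
  rw [Finset.insert_comm]
  exact sgp_insert h fun S hS hc => hs S (Finset.mem_powerset.2 hS) hc

lemma depth_insert_self {d : ℕ} [Nontrivial (E d)] {R : Finset (E d)} {x : E d} {j : ℕ} (hx : x ∉ R)
    (hj : 1 ≤ j) (h1 : DGE R x (j - 1)) (h2 : ¬ DGE R x j) : tukeyDepth (insert x R) x = j := by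
  apply le_antisymm
  · by_contra! hc
    apply h2
    intro v hv
    have := (le_depth_iff _ _ _).1 hc v hv
    rw [cnt_insert_of_le hx le_rfl] at this
    omega
  · rw [le_depth_iff]
    intro v hv
    rw [cnt_insert_of_le hx le_rfl]
    have := h1 v hv
    omega

lemma depth_insert_le {d : ℕ} [Nontrivial (E d)] (R : Finset (E d)) (x p : E d) :
    tukeyDepth (insert x R) p ≤ tukeyDepth R p + 1 := by
  obtain ⟨v, hv, h⟩ := exists_depth R p
  refine (dge_depth (insert x R) p v hv).trans ?_
  rw [← h]
  unfold cnt
  rw [Finset.filter_insert]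
  split_ifs
  · exact Finset.card_insert_le _ _
  · omega

lemma planar_step {t : ℕ → ℝ} {N j : ℕ} (ht : ∀ l < N, 0 < t l) (h : SGP (insert 0 (RN t N)))
    (hj : 1 ≤ j) (hjN : j = 1 ∨ 2 * j - 1 ≤ N) (hdep : ∀ p ∈ RN t N, tukeyDepth (RN t N) p ≤ j) :
    ∃ s : ℝ, 0 < s ∧ SGP (insert 0 (insert (s • u N) (RN t N))) ∧ s • u N ∉ RN t N ∧
      tukeyDepth (insert (s • u N) (RN t N)) (s • u N) = j ∧
      ∀ p ∈ RN t N, tukeyDepth (insert (s • u N) (RN t N)) p = tukeyDepth (RN t N) p := by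
  have h0 : (0 : E 2) ∉ RN t N := by
    rw [mem_RN]
    rintro ⟨l, hl, h⟩
    exact smul_u_ne_zero (ht l hl).ne' l h
  have hnot : ∀ s : ℝ, 0 ≤ s → s • u N ∉ RN t N := by
    intro s hs hm
    obtain ⟨l, hl, hh⟩ := mem_RN.1 hm
    exact hl.ne (u_npar (ht l hl).ne' hh)
  have hcard := RN_card ht
  suffices hs : ∃ a : ℝ, 0 ≤ a ∧ ∀ᶠ s in 𝓝[>] a, SGP (insert 0 (insert (s • u N) (RN t N))) →
      (DGE (RN t N) (s • u N) (j - 1) ∧ ¬ DGE (RN t N) (s • u N) j) ∧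
      ∀ p ∈ RN t N, tukeyDepth (insert (s • u N) (RN t N)) p ≤ j by
    obtain ⟨a, ha, hs⟩ := hs
    have hpos : ∀ᶠ s in 𝓝[>] a, 0 < s := by
      filter_upwards [self_mem_nhdsWithin] with s hs using ha.trans_lt hs
    obtain ⟨s, hs1, hs2, hs3⟩ := (hs.and (hpos.and (planar_sgp ht h ha))).exists
    obtain ⟨⟨h1, h2⟩, h3⟩ := hs1 hs3
    have hx := hnot s hs2.le
    have hd := depth_insert_self hx hj h1 h2
    refine ⟨s, hs2, hs3, hx, hd, fun p hp => ?_⟩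
    exact (depth_insert hx hp (by rw [hd]; exact h3 p hp)).symm
  by_cases hD : DGE (RN t N) 0 j
  · obtain ⟨a, ha, hz, hev⟩ := exists_leave (h.mono (Finset.subset_insert _ _)).fib (u_ne_zero N) hj hD
    simp only [zero_add] at hz hev
    refine ⟨a, ha, ?_⟩
    have hall : ∀ᶠ s in 𝓝[>] a, ∀ p ∈ RN t N, tukeyDepth (insert (s • u N) (RN t N)) p ≤ j := by
      rw [Filter.eventually_all_finset]
      intro p hp
      rcases (hdep p hp).lt_or_eq with hlt | heq
      · exact Eventually.of_forall fun s => (depth_insert_le _ _ _).trans hlt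
      · obtain ⟨v, hv, hcv⟩ := exists_depth (RN t N) p
        have hlt : ⟪v, p⟫ < ⟪v, a • u N⟫ := by
          by_contra! hc
          have := dge_two_point hz hp (by rintro hh; exact hnot a ha (hh ▸ hp)) hv hc
          omega
        have c : Continuous fun s : ℝ => ⟪v, s • u N⟫ := by fun_prop
        have hlt' := ((c.tendsto a).eventually_const_lt hlt).filter_mono
          (nhdsWithin_le_nhds (s := Set.Ioi a))
        filter_upwards [hlt'] with s hs
        have := dge_depth (insert (s • u N) (RN t N)) p v hv
        rw [cnt_insert_of_lt hs] at this
        omega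
    filter_upwards [hev, hall] with s h1 h2 _ using ⟨h1, h2⟩
  · refine ⟨0, le_rfl, ?_⟩
    have hNj : N ≤ 2 * j := by
      by_contra! hc
      exact hD ((RN_dge ht).mono (by omega))
    have h1 : DGE (RN t N) 0 (j - 1) := (RN_dge ht).mono (by omega)
    have c : Continuous fun s : ℝ => s • u N := by fun_prop
    have c0 := (c.tendsto 0).mono_left (nhdsWithin_le_nhds (s := Set.Ioi 0))
    simp only [zero_smul] at c0
    have h2 := c0.eventually (dge_eventually_self h.fib h0 h1)
    have h3 := c0.eventually (not_dge_eventually hD)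
    filter_upwards [h2, h3, self_mem_nhdsWithin] with s hs2 hs3 hs hsgp
    refine ⟨⟨hs2, hs3⟩, fun p hp => ?_⟩
    have hc : (insert (s • u N) (RN t N)).card = N + 1 := by
      rw [Finset.card_insert_of_notMem (hnot s (le_of_lt hs)), hcard]
    have hN : 0 < (RN t N).card := Finset.card_pos.2 ⟨p, hp⟩
    have := planar_depth_le (hsgp.mono (Finset.subset_insert _ _)) (Finset.mem_insert_of_mem hp)
      (by omega)
    omega

lemma planar_construct {ι : Type*} (δ : ι → ℕ) (A : Finset ι) :
    (∀ a ∈ A, 1 ≤ δ a ∧ (δ a = 1 ∨ 2 * δ a - 1 ≤ (A.filter fun b => δ b < δ a).card)) →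
    ∃ t : ℕ → ℝ, (∀ l < A.card, 0 < t l) ∧ SGP (insert 0 (RN t A.card)) ∧
      ∀ j, depthHistogram (RN t A.card) j = (A.filter fun a => δ a = j).card := by
  classical
  induction A using Finset.induction_on_max_value δ with
  | empty =>
    intro _
    refine ⟨fun _ => 1, by simp, ?_, ?_⟩
    · have : RN (fun _ => 1) (∅ : Finset ι).card = ∅ := by simp [RN]
      rw [this]
      intro S hS _
      have hsub : Subsingleton {x // x ∈ S} := by
        constructor
        rintro ⟨a, ha⟩ ⟨b, hb⟩
        have h1 := hS ha
        have h2 := hS hb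
        simp at h1 h2
        simp [h1, h2]
      exact affineIndependent_of_subsingleton ℝ _
    · intro j
      simp [RN, depthHistogram]
  | insert a s ha hmax ih =>
    intro hcond
    obtain ⟨t, ht, hsgp, hhist⟩ := ih (by
      intro b hb
      have h1 := hcond b (Finset.mem_insert_of_mem hb)
      rwa [Finset.filter_insert, if_neg (by have := hmax b hb; omega)] at h1)
    have hca := hcond a (Finset.mem_insert_self _ _)
    rw [Finset.filter_insert, if_neg (by omega)] at hca
    have hle : (s.filter fun b => δ b < δ a).card ≤ s.card := Finset.card_filter_le _ _
    obtain ⟨x, hx, h1, h2, h3, h4⟩ := planar_step (j := δ a) ht hsgp hca.1 (by omega) (by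
      intro p hp
      have : 0 < depthHistogram (RN t s.card) (tukeyDepth (RN t s.card) p) :=
        Finset.card_pos.2 ⟨p, by simp [hp]⟩
      rw [hhist] at this
      obtain ⟨b, hb⟩ := Finset.card_pos.1 this
      rw [Finset.mem_filter] at hb
      rw [← hb.2]
      exact hmax b hb.1)
    have hRN : RN (Function.update t s.card x) (insert a s).card = insert (x • u s.card) (RN t s.card) := by
      rw [Finset.card_insert_of_notMem ha]
      ext p
      simp only [mem_RN, Finset.mem_insert]
      constructor
      · rintro ⟨l, hl, rfl⟩
        by_cases hls : l = s.card
        · left; subst hls; simp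
        · right; exact ⟨l, by omega, by simp [Function.update_of_ne hls]⟩
      · rintro (rfl | ⟨l, hl, rfl⟩)
        · exact ⟨s.card, by omega, by simp⟩
        · exact ⟨l, by omega, by simp [Function.update_of_ne hl.ne]⟩
    refine ⟨Function.update t s.card x, ?_, ?_, ?_⟩
    · intro l hl
      rw [Finset.card_insert_of_notMem ha] at hl
      by_cases hls : l = s.card
      · subst hls; simpa using hx
      · rw [Function.update_of_ne hls]; exact ht l (by omega)
    · rw [hRN]; exact h1
    · intro j
      rw [hRN, Finset.filter_insert]
      have e : (RN t s.card).filter (fun p => tukeyDepth (insert (x • u s.card) (RN t s.card)) p = j) =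
          (RN t s.card).filter (fun p => tukeyDepth (RN t s.card) p = j) :=
        Finset.filter_congr fun p hp => by rw [h4 p hp]
      unfold depthHistogram at hhist ⊢
      rw [Finset.filter_insert, h3, e]
      split_ifs
      · rw [Finset.card_insert_of_notMem (by simp [h2]), Finset.card_insert_of_notMem (by simp [ha]), hhist]
      · rw [hhist]

lemma exists_gen {d : ℕ} (W : Finset (E d)) : (∀ w ∈ W, w ≠ 0) → ∀ U : Set (E d), IsOpen U →
    U.Nonempty → ∃ v ∈ U, ∀ w ∈ W, ⟪v, w⟫ ≠ 0 := by
  classical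
  induction W using Finset.induction_on with
  | empty => 
    rintro - U - ⟨v, hv⟩
    exact ⟨v, hv, by simp⟩
  | insert w W hw ih =>
    rintro hW U hU ⟨v0, hv0⟩
    have hw0 : w ≠ 0 := hW w (Finset.mem_insert_self _ _)
    have ho : IsOpen (U ∩ {v : E d | ⟪v, w⟫ ≠ 0}) :=
      hU.inter (isOpen_ne_fun (by fun_prop) (by fun_prop))
    have hne : (U ∩ {v : E d | ⟪v, w⟫ ≠ 0}).Nonempty := by
      by_cases h0 : ⟪v0, w⟫ = 0
      · have c : Continuous fun s : ℝ => v0 + s • w := by fun_prop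
        have h1 : ∀ᶠ s in 𝓝 (0 : ℝ), v0 + s • w ∈ U :=
          (c.tendsto 0).eventually (hU.mem_nhds (by simpa using hv0))
        have h2 := h1.filter_mono (nhdsWithin_le_nhds (s := Set.Ioi 0))
        obtain ⟨s, hs1, hs2⟩ := (h2.and self_mem_nhdsWithin).exists
        refine ⟨v0 + s • w, hs1, ?_⟩
        simp only [Set.mem_ofPred_eq, inner_add_left, h0, inner_smul_left, zero_add]
        exact mul_ne_zero (ne_of_gt hs2) (inner_self_ne_zero.2 hw0)
      · exact ⟨v0, hv0, h0⟩
    obtain ⟨v, hv, h⟩ := ih (fun w' h' => hW w' (Finset.mem_insert_of_mem h')) _ ho hne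
    refine ⟨v, hv.1, fun w' h' => ?_⟩
    rcases Finset.mem_insert.1 h' with rfl | h'
    · exact hv.2
    · exact h w' h'

lemma exists_gen_pt {d : ℕ} [Nontrivial (E d)] (L : Finset (E d)) {p : E d} (hp : p ∉ L)
    (U : Set (E d)) (hU : IsOpen U) (hne : U.Nonempty) :
    ∃ v ∈ U, v ≠ 0 ∧ ∀ l ∈ L, ⟪v, l⟫ ≠ ⟪v, p⟫ := by
  classical
  obtain ⟨z, hz⟩ := exists_ne (0 : E d)
  obtain ⟨v, hv, h⟩ := exists_gen (insert z (L.image fun l => l - p)) (by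
    intro w hw
    rcases Finset.mem_insert.1 hw with rfl | hw
    · exact hz
    · obtain ⟨l, hl, rfl⟩ := Finset.mem_image.1 hw
      rw [sub_ne_zero]
      rintro rfl
      exact hp hl) U hU hne
  refine ⟨v, hv, ?_, fun l hl hh => ?_⟩
  · rintro rfl
    exact h z (Finset.mem_insert_self _ _) (inner_zero_left _)
  · apply h (l - p) (Finset.mem_insert_of_mem (Finset.mem_image_of_mem _ hl))
    rw [inner_sub_right, hh, sub_self]

lemma cnt_split {d : ℕ} {L : Finset (E d)} {p v : E d} (h : ∀ l ∈ L, ⟪v, l⟫ ≠ ⟪v, p⟫) :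
    cnt L v p + cnt L (-v) p = L.card := by
  unfold cnt
  simp only [inner_neg_left, neg_le_neg_iff]
  rw [← Finset.card_filter_add_card_filter_not (s := L) (fun x => ⟪v, x⟫ ≤ ⟪v, p⟫)]
  congr 2
  apply Finset.filter_congr
  intro x hx
  rw [not_le]
  exact ⟨fun hh => lt_of_le_of_ne hh (h x hx).symm, le_of_lt⟩

lemma dge_half {d : ℕ} [Nontrivial (E d)] {L : Finset (E d)} {p : E d} {s : ℕ} (hp : p ∉ L)
    (h : DGE L p s) : 2 * s ≤ L.card := by
  obtain ⟨v, -, hv, hg⟩ := exists_gen_pt L hp Set.univ isOpen_univ Set.univ_nonempty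
  have h1 := h v hv
  have h2 := h (-v) (neg_ne_zero.2 hv)
  have := cnt_split hg
  omega

lemma exists_perp {d : ℕ} {p₁ p₂ r : E d} (hne : p₁ ≠ p₂) (hr : r ∉ line[ℝ, p₁, p₂]) :
    ∃ w : E d, ⟪w, p₂ - p₁⟫ = 0 ∧ 0 < ⟪w, r - p₁⟫ := by
  have he : p₂ - p₁ ≠ 0 := sub_ne_zero.2 hne.symm
  have hee : ⟪p₂ - p₁, p₂ - p₁⟫ ≠ 0 := inner_self_ne_zero.2 he
  set c : ℝ := ⟪p₂ - p₁, r - p₁⟫ / ⟪p₂ - p₁, p₂ - p₁⟫ with hc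
  set w : E d := (r - p₁) - c • (p₂ - p₁) with hw
  have h0 : ⟪w, p₂ - p₁⟫ = 0 := by
    rw [hw, inner_sub_left, real_inner_smul_left, hc, div_mul_cancel₀ _ hee, real_inner_comm, sub_self]
  have hw0 : w ≠ 0 := by
    intro h
    apply hr
    have : r = AffineMap.lineMap p₁ p₂ c := by
      rw [AffineMap.lineMap_apply, vsub_eq_sub, vadd_eq_add]
      rw [hw, sub_eq_zero] at h
      rw [← h]; abel
    rw [this]
    exact AffineMap.lineMap_mem_affineSpan_pair _ _ _
  refine ⟨w, h0, ?_⟩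
  have : r - p₁ = w + c • (p₂ - p₁) := by rw [hw]; abel
  rw [this, inner_add_right, real_inner_smul_right, h0]
  have := real_inner_self_pos.2 hw0
  linarith

lemma exists_strip {d : ℕ} {p₁ p₂ r : E d} (hne : p₁ ≠ p₂) (hr : r ∉ line[ℝ, p₁, p₂]) :
    ∃ v : E d, ⟪v, p₁⟫ < ⟪v, r⟫ ∧ ⟪v, r⟫ < ⟪v, p₂⟫ := by
  obtain ⟨w, h0, h1⟩ := exists_perp hne hr
  have he : 0 < ⟪p₂ - p₁, p₂ - p₁⟫ := real_inner_self_pos.2 (sub_ne_zero.2 hne.symm)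
  set α : ℝ := (⟪p₂ - p₁, p₂ - p₁⟫ / 2 - ⟪p₂ - p₁, r - p₁⟫) / ⟪w, r - p₁⟫ with hα
  have a1 : ⟪(p₂ - p₁) + α • w, r - p₁⟫ = ⟪p₂ - p₁, p₂ - p₁⟫ / 2 := by
    rw [inner_add_left, real_inner_smul_left, hα, div_mul_cancel₀ _ h1.ne']
    ring
  have a2 : ⟪(p₂ - p₁) + α • w, p₂ - p₁⟫ = ⟪p₂ - p₁, p₂ - p₁⟫ := by
    rw [inner_add_left, real_inner_smul_left, h0]
    ring
  rw [inner_sub_right _ r] at a1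
  rw [inner_sub_right _ p₂ p₁] at a2
  refine ⟨(p₂ - p₁) + α • w, by linarith, by linarith⟩

lemma strip_line {d : ℕ} [Nontrivial (E d)] {L : Finset (E d)} {p₁ p₂ r : E d} {s : ℕ}
    (hne : p₁ ≠ p₂) (hp₁ : p₁ ∉ L) (h1 : DGE L p₁ s) (h2 : DGE L p₂ s) (hL : L.card = 2 * s)
    (hr : r ∈ L) : r ∈ line[ℝ, p₁, p₂] := by
  classical
  by_contra hc
  obtain ⟨v0, hv1, hv2⟩ := exists_strip hne hc
  have ho : IsOpen {v : E d | ⟪v, p₁⟫ < ⟪v, r⟫ ∧ ⟪v, r⟫ < ⟪v, p₂⟫} :=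
    have i1 : IsOpen {v : E d | ⟪v, p₁⟫ < ⟪v, r⟫} := isOpen_lt (by fun_prop) (by fun_prop)
    have i2 : IsOpen {v : E d | ⟪v, r⟫ < ⟪v, p₂⟫} := isOpen_lt (by fun_prop) (by fun_prop)
    i1.and i2
  obtain ⟨v, ⟨hva, hvb⟩, hv, hg⟩ := exists_gen_pt L hp₁ _ ho ⟨v0, hv1, hv2⟩
  have e := cnt_split hg
  have a1 := h1 v hv
  have a2 := h2 (-v) (neg_ne_zero.2 hv)
  have a3 : cnt L (-v) p₂ + 1 ≤ cnt L (-v) p₁ := by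
    unfold cnt
    simp only [inner_neg_left, neg_le_neg_iff]
    rw [← Finset.card_insert_of_notMem (a := r) (by simp [hvb])]
    apply Finset.card_le_card
    intro x hx
    rcases Finset.mem_insert.1 hx with rfl | hx
    · simp [hr, hva.le]
    · rw [Finset.mem_filter] at hx ⊢
      exact ⟨hx.1, by linarith [hx.2]⟩
  omega

lemma all_on_line {d : ℕ} [Nontrivial (E d)] {P : Finset (E d)} {p₁ p₂ : E d} (hne : p₁ ≠ p₂)
    (h : ∀ r ∈ P, tukeyDepth P r = 1 → r ∈ line[ℝ, p₁, p₂]) {s : E d} (hs : s ∈ P) :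
    s ∈ line[ℝ, p₁, p₂] := by
  classical
  by_contra hc
  obtain ⟨w, h0, h1⟩ := exists_perp hne hc
  set L := P.filter fun l => l ∈ line[ℝ, p₁, p₂] with hL
  have ho : IsOpen {v : E d | ∀ l ∈ L, ⟪v, l⟫ < ⟪v, s⟫} := by
    have : {v : E d | ∀ l ∈ L, ⟪v, l⟫ < ⟪v, s⟫} = ⋂ l ∈ L, {v : E d | ⟪v, l⟫ < ⟪v, s⟫} := by
      ext v; simp
    rw [this]
    exact isOpen_biInter_finset fun l _ => isOpen_lt (by fun_prop) (by fun_prop)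
  have hw : w ∈ {v : E d | ∀ l ∈ L, ⟪v, l⟫ < ⟪v, s⟫} := by
    intro l hl
    obtain ⟨c, rfl⟩ := (mem_affineSpan_pair_iff_exists_lineMap_eq).1 (Finset.mem_filter.1 hl).2
    rw [AffineMap.lineMap_apply, vsub_eq_sub, vadd_eq_add, inner_add_right, real_inner_smul_right, h0]
    rw [inner_sub_right] at h1
    linarith
  obtain ⟨z, hz⟩ := exists_ne (0 : E d)
  obtain ⟨v, hv, hg⟩ := exists_gen (insert z (P.offDiag.image fun x => x.1 - x.2)) (by
    intro w hw
    rcases Finset.mem_insert.1 hw with rfl | hw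
    · exact hz
    · obtain ⟨l, hl, rfl⟩ := Finset.mem_image.1 hw
      rw [sub_ne_zero]
      exact (Finset.mem_offDiag.1 hl).2.2) _ ho ⟨w, hw⟩
  have hv0 : v ≠ 0 := by
    rintro rfl
    exact hg z (Finset.mem_insert_self _ _) (inner_zero_left _)
  obtain ⟨x, hx, hmax⟩ := Finset.exists_max_image P (fun x => ⟪v, x⟫) ⟨s, hs⟩
  have hcx : cnt P (-v) x ≤ 1 := by
    unfold cnt
    rw [Finset.card_le_one]
    have key : ∀ a ∈ P.filter (fun y => ⟪-v, y⟫ ≤ ⟪-v, x⟫), a = x := by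
      intro a ha
      rw [Finset.mem_filter, inner_neg_left, inner_neg_left, neg_le_neg_iff] at ha
      by_contra hax
      apply hg (a - x) (Finset.mem_insert_of_mem (Finset.mem_image.2
        ⟨(a, x), Finset.mem_offDiag.2 ⟨ha.1, hx, hax⟩, rfl⟩))
      rw [inner_sub_right, sub_eq_zero]
      exact le_antisymm (hmax a ha.1) ha.2
    intro a ha b hb
    rw [key a ha, key b hb]
  have hd := dge_depth P x (-v) (neg_ne_zero.2 hv0)
  have hp := depth_pos hx
  have hxl := h x hx (by omega)
  have := hv x (Finset.mem_filter.2 ⟨hx, hxl⟩)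
  exact absurd (hmax s hs) (not_le.2 this)

lemma mid_depth {d : ℕ} [Nontrivial (E d)] {P : Finset (E d)} {x y z : E d} (hy : y ∈ P)
    (hxy : x ≠ y) (hzy : z ≠ y) (h : Wbtw ℝ x y z) :
    tukeyDepth P x < tukeyDepth P y ∨ tukeyDepth P z < tukeyDepth P y := by
  obtain ⟨v, hv, hc⟩ := exists_depth P y
  obtain ⟨c, ⟨hc0, hc1⟩, rfl⟩ := h
  rcases le_total ⟪v, x⟫ ⟪v, z⟫ with hle | hle
  · left
    have := dge_two_point (dge_depth P x) hy hxy hv (by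
      rw [AffineMap.lineMap_apply, vsub_eq_sub, vadd_eq_add, inner_add_right, real_inner_smul_right,
        inner_sub_right]
      nlinarith)
    omega
  · right
    have := dge_two_point (dge_depth P z) hy hzy hv (by
      rw [AffineMap.lineMap_apply, vsub_eq_sub, vadd_eq_add, inner_add_right, real_inner_smul_right,
        inner_sub_right]
      nlinarith)
    omega

lemma level_le_two {d : ℕ} [Nontrivial (E d)] {P : Finset (E d)} {p₁ p₂ : E d}
    (h : ∀ s ∈ P, s ∈ line[ℝ, p₁, p₂]) (j : ℕ) :
    (P.filter fun p => tukeyDepth P p = j).card ≤ 2 := by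
  by_contra! hc
  obtain ⟨a, ha, b, hb, c, hc, hab, hac, hbc⟩ := Finset.two_lt_card.1 hc
  rw [Finset.mem_filter] at ha hb hc
  have hcol : Collinear ℝ ({a, b, c} : Set (E d)) :=
    collinear_triple_of_mem_affineSpan_pair (h a ha.1) (h b hb.1) (h c hc.1)
  rcases hcol.wbtw_or_wbtw_or_wbtw with hw | hw | hw
  · have := mid_depth hb.1 hab hbc.symm hw
    omega
  · have := mid_depth hc.1 hbc hac hw
    omega
  · have := mid_depth ha.1 hac.symm hab.symm hw
    omega

lemma dge_lower {d : ℕ} [Nontrivial (E d)] {P : Finset (E d)} {p : E d} (hp : p ∈ P) {k : ℕ}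
    (hk : k ≤ tukeyDepth P p) (hgap : ∀ r ∈ P, k ≤ tukeyDepth P r → tukeyDepth P p ≤ tukeyDepth P r) :
    DGE (P.filter fun r => tukeyDepth P r < k) p (tukeyDepth P p - 1) := by
  classical
  set L := P.filter fun r => tukeyDepth P r < k with hL
  have hpL : p ∉ L := by simp [hL, hk]
  have hsub : insert p L ⊆ P := Finset.insert_subset hp (Finset.filter_subset _ _)
  have hd : tukeyDepth (insert p L) p = tukeyDepth P p := by
    refine depth_down' hsub ?_ (Finset.mem_insert_self _ _)
    intro x hx r hr hrQ
    have hkr : k ≤ tukeyDepth P r := by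
      by_contra! hlt
      exact hrQ (Finset.mem_insert_of_mem (Finset.mem_filter.2 ⟨hr, hlt⟩))
    rcases Finset.mem_insert.1 hx with rfl | hx
    · exact hgap r hr hkr
    · exact (Finset.mem_filter.1 hx).2.le.trans hkr
  intro v hv
  have := dge_depth (insert p L) p v hv
  rw [cnt_insert_of_le hpL le_rfl, hd] at this
  omega

lemma lower_card {d : ℕ} [Nontrivial (E d)] {P : Finset (E d)} {p : E d} (hp : p ∈ P) {k : ℕ}
    (hk : k ≤ tukeyDepth P p) (hgap : ∀ r ∈ P, k ≤ tukeyDepth P r → tukeyDepth P p ≤ tukeyDepth P r) :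
    2 * (tukeyDepth P p - 1) ≤ (P.filter fun r => tukeyDepth P r < k).card :=
  dge_half (by simp [hk]) (dge_lower hp hk hgap)

lemma small_cond {d : ℕ} [Nontrivial (E d)] {P : Finset (E d)} {q p : E d} {i : ℕ}
    (hq : q ∈ P) (hiq : i < tukeyDepth P q)
    (hgap : ∀ r ∈ P, i ≤ tukeyDepth P r → tukeyDepth P q ≤ tukeyDepth P r)
    (hp : p ∈ P) (hpi : tukeyDepth P p < i) (hp2 : 2 ≤ tukeyDepth P p) :
    2 * tukeyDepth P p - 1 ≤ (P.filter fun r => tukeyDepth P r < tukeyDepth P p).card := by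
  classical
  set j := tukeyDepth P p with hj
  have hLj := lower_card hp (le_refl (tukeyDepth P p)) (fun r _ h => h)
  rw [← hj] at hLj
  by_contra! hlt
  have hcard : (P.filter fun r => tukeyDepth P r < j).card = 2 * (j - 1) := by omega
  -- next occupied level
  obtain ⟨n, hn, hmin⟩ := Finset.exists_min_image (P.filter fun r => j + 1 ≤ tukeyDepth P r)
    (tukeyDepth P) ⟨q, by simp [hq]; omega⟩
  rw [Finset.mem_filter] at hn
  have hnext := lower_card hn.1 hn.2 (fun r hr h => hmin r (Finset.mem_filter.2 ⟨hr, h⟩))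
  have hsplit : (P.filter fun r => tukeyDepth P r < j + 1).card =
      (P.filter fun r => tukeyDepth P r < j).card + (P.filter fun r => tukeyDepth P r = j).card := by
    rw [← Finset.card_union_of_disjoint]
    · rw [← Finset.filter_or]
      congr 1
      apply Finset.filter_congr
      intro x _
      omega
    · rw [Finset.disjoint_filter]
      intro x _ h
      omega
  have htwo : 1 < (P.filter fun r => tukeyDepth P r = j).card := by omega
  obtain ⟨a, ha, b, hb, hab⟩ := Finset.one_lt_card.1 htwo
  rw [Finset.mem_filter] at ha hb
  have hLa := dge_lower ha.1 ha.2.ge (fun r _ h => by rw [ha.2]; exact h)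
  have hLb := dge_lower hb.1 hb.2.ge (fun r _ h => by rw [hb.2]; exact h)
  rw [ha.2] at hLa
  rw [hb.2] at hLb
  have hline : ∀ r ∈ P, tukeyDepth P r = 1 → r ∈ line[ℝ, a, b] := by
    intro r hr h1
    exact strip_line hab (by simp [ha.2]) hLa hLb hcard (Finset.mem_filter.2 ⟨hr, by omega⟩)
  have hlev := level_le_two (fun s hs => all_on_line hab hline hs)
  have hR := lower_card hq hiq.le hgap
  have hup : (P.filter fun r => tukeyDepth P r < i).card ≤ 2 * (Finset.Icc 1 (i - 1)).card := by
    apply Finset.card_le_mul_card_image_of_maps_to (f := tukeyDepth P)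
    · intro x hx
      rw [Finset.mem_filter] at hx
      have := depth_pos hx.1
      simp only [Finset.mem_Icc]
      omega
    · intro k _
      refine le_trans (Finset.card_le_card ?_) (hlev k)
      intro x hx
      rw [Finset.mem_filter, Finset.mem_filter] at hx
      exact Finset.mem_filter.2 ⟨hx.1.1, hx.2⟩
  simp at hup
  omega
lemma exists_isometry {d : ℕ} (hd : 2 ≤ d) : Nonempty (E 2 →ₗᵢ[ℝ] E d) := by
  let b := EuclideanSpace.basisFun (Fin 2) ℝ
  let c := EuclideanSpace.basisFun (Fin d) ℝ
  refine ⟨LinearMap.isometryOfOrthonormal (v := b.toBasis)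
    (b.toBasis.constr ℝ fun k => c (Fin.castLE hd k)) ?_ ?_⟩
  · simp
  · have : (b.toBasis.constr ℝ fun k => c (Fin.castLE hd k)) ∘ b.toBasis =
        c ∘ Fin.castLE hd := by
      ext1 k
      simp only [Function.comp_apply, Module.Basis.constr_basis]
    rw [this]
    exact c.orthonormal.comp _ (Fin.castLE_injective hd)

lemma cnt_image {d : ℕ} (f : E 2 →ₗᵢ[ℝ] E d) (Q : Finset (E 2)) (p w : E 2) (v : E d)
    (h : ∀ x, ⟪v, f x⟫ = ⟪w, x⟫) : cnt (Q.map ⟨f, f.injective⟩) v (f p) = cnt Q w p := by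
  unfold cnt
  rw [Finset.filter_map, Finset.card_map]
  congr 1
  apply Finset.filter_congr
  intro x _
  simp [h]

lemma depth_image {d : ℕ} [Nontrivial (E d)] (f : E 2 →ₗᵢ[ℝ] E d) (Q : Finset (E 2)) (p : E 2) :
    tukeyDepth (Q.map ⟨f, f.injective⟩) (f p) = tukeyDepth Q p := by
  apply le_antisymm
  · rw [le_depth_iff]
    intro v hv
    rw [← cnt_image f Q p v (f v) (fun x => f.inner_map_map v x)]
    exact dge_depth _ _ _ (fun h => hv (f.injective (by rw [h, map_zero])))
  · rw [le_depth_iff]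
    intro v hv
    set w := LinearMap.adjoint f.toLinearMap v with hw
    rw [cnt_image f Q p w v (fun x => by rw [hw, LinearMap.adjoint_inner_left]; rfl)]
    by_cases h0 : w = 0
    · obtain ⟨z, hz⟩ := exists_ne (0 : E 2)
      refine (dge_depth Q p z hz).trans ?_
      unfold cnt
      apply Finset.card_le_card
      intro x hx
      simp [h0, (Finset.mem_filter.1 hx).1]
    · exact dge_depth Q p w h0

lemma hist_image {d : ℕ} [Nontrivial (E d)] (f : E 2 →ₗᵢ[ℝ] E d) (Q : Finset (E 2)) (j : ℕ) :
    depthHistogram (Q.map ⟨f, f.injective⟩) j = depthHistogram Q j := by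
  unfold depthHistogram
  rw [Finset.filter_map, Finset.card_map]
  congr 1
  apply Finset.filter_congr
  intro x _
  have := depth_image f Q x
  simp [this]

lemma genPos_mono {d : ℕ} {P Q : Finset (E d)} (hP : GenPos P) (h : Q ⊆ P) : GenPos Q :=
  fun S hS hc => hP S (hS.trans h) hc

lemma hist_down {d : ℕ} [Nontrivial (E d)] {P Q : Finset (E d)} (h : Q ⊆ P)
    (hd : ∀ p ∈ Q, ∀ r ∈ P, r ∉ Q → tukeyDepth P p ≤ tukeyDepth P r) (j : ℕ) :
    depthHistogram Q j = (Q.filter fun p => tukeyDepth P p = j).card := by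
  unfold depthHistogram
  congr 1
  apply Finset.filter_congr
  intro x hx
  rw [depth_down' h hd hx]

lemma part_one {d : ℕ} [Nontrivial (E d)] (P : Finset (E d)) (hP : GenPos P) (i : ℕ) :
    ∃ Q : Finset (E d), GenPos Q ∧
      (∀ j ≤ i, depthHistogram Q j = depthHistogram P j) ∧
      (∀ j, i < j → depthHistogram Q j = 0) := by
  have hsub : P.filter (fun p => tukeyDepth P p ≤ i) ⊆ P := Finset.filter_subset _ _
  have hh := hist_down hsub (by
    intro p hp r hr hrQ
    simp only [Finset.mem_filter, not_and, not_le] at hp hrQ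
    exact hp.2.trans (hrQ hr).le)
  refine ⟨_, genPos_mono hP hsub, fun j hj => ?_, fun j hj => ?_⟩
  · rw [hh, Finset.filter_filter]
    unfold depthHistogram
    congr 1
    apply Finset.filter_congr
    intro x _
    omega
  · rw [hh, Finset.filter_filter, Finset.card_eq_zero, Finset.filter_eq_empty_iff]
    intro x _
    omega

/-- the histogram of `insert x R`, where `R` is the set of points of depth less than `i` and
`x` has depth `i` -/
lemma hist_insert {d : ℕ} {P Q : Finset (E d)} {x : E d} {i : ℕ}
    (hx : x ∉ P.filter fun p => tukeyDepth P p < i)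
    (hQ : Q = insert x (P.filter fun p => tukeyDepth P p < i))
    (hxi : tukeyDepth Q x = i)
    (hR : ∀ p ∈ P.filter fun p => tukeyDepth P p < i, tukeyDepth Q p = tukeyDepth P p) :
    (∀ j < i, depthHistogram Q j = depthHistogram P j) ∧ depthHistogram Q i = 1 ∧
      (∀ j, i < j → depthHistogram Q j = 0) := by
  have key : ∀ j, depthHistogram Q j =
      ((P.filter fun p => tukeyDepth P p < i).filter fun p => tukeyDepth P p = j).card +
        if i = j then 1 else 0 := by
    intro j
    have e : (P.filter fun p => tukeyDepth P p < i).filter (fun p => tukeyDepth Q p = j) =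
        (P.filter fun p => tukeyDepth P p < i).filter (fun p => tukeyDepth P p = j) :=
      Finset.filter_congr fun p hp => by rw [hR p hp]
    have : Q.filter (fun p => tukeyDepth Q p = j) =
        (insert x (P.filter fun p => tukeyDepth P p < i)).filter (fun p => tukeyDepth Q p = j) :=
      congrArg (Finset.filter _) hQ
    unfold depthHistogram
    rw [this, Finset.filter_insert, hxi, e]
    split_ifs
    · rw [Finset.card_insert_of_notMem]
      intro h
      exact hx (Finset.mem_filter.1 h).1
    · rfl
  refine ⟨fun j hj => ?_, ?_, fun j hj => ?_⟩
  · rw [key, if_neg (by omega), Finset.filter_filter, add_zero]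
    unfold depthHistogram
    congr 1
    apply Finset.filter_congr
    intro x _
    omega
  · rw [key, if_pos rfl, Finset.filter_filter, Nat.add_eq_right, Finset.card_eq_zero,
      Finset.filter_eq_empty_iff]
    intro x _
    omega
  · rw [key, if_neg (by omega), Finset.filter_filter, add_zero, Finset.card_eq_zero,
      Finset.filter_eq_empty_iff]
    intro x _
    omega

lemma part_two {d : ℕ} [Nontrivial (E d)] (P : Finset (E d)) (hP : GenPos P) (i : ℕ) (hi : 1 ≤ i)
    (hex : ∃ p ∈ P, i ≤ tukeyDepth P p) :
    ∃ Q : Finset (E d), GenPos Q ∧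
      (∀ j < i, depthHistogram Q j = depthHistogram P j) ∧ depthHistogram Q i = 1 ∧
      (∀ j, i < j → depthHistogram Q j = 0) := by
  classical
  obtain ⟨p0, hp0, hp0i⟩ := hex
  obtain ⟨q, hq, hmin⟩ := Finset.exists_min_image (P.filter fun r => i ≤ tukeyDepth P r)
    (tukeyDepth P) ⟨p0, Finset.mem_filter.2 ⟨hp0, hp0i⟩⟩
  rw [Finset.mem_filter] at hq
  obtain ⟨hqP, hqi⟩ := hq
  have hgap : ∀ r ∈ P, i ≤ tukeyDepth P r → tukeyDepth P q ≤ tukeyDepth P r :=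
    fun r hr h => hmin r (Finset.mem_filter.2 ⟨hr, h⟩)
  set R := P.filter fun p => tukeyDepth P p < i with hRdef
  have hqR : q ∉ R := by simp [hRdef, hqi]
  have hRP : R ⊆ P := Finset.filter_subset _ _
  have hnotR : ∀ r ∈ P, r ∉ R → i ≤ tukeyDepth P r := by
    intro r hr h
    by_contra! hlt
    exact h (Finset.mem_filter.2 ⟨hr, hlt⟩)
  have hRlt : ∀ r ∈ R, tukeyDepth P r < i := fun r hr => (Finset.mem_filter.1 hr).2
  have hRd : ∀ p ∈ R, tukeyDepth R p = tukeyDepth P p := fun p hp =>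
    depth_down' hRP (fun p hp r hr hrR => (hRlt p hp).le.trans (hnotR r hr hrR)) hp
  have hQP : insert q R ⊆ P := Finset.insert_subset hqP hRP
  rcases hqi.eq_or_lt with heq | hlt
  · have hdn : ∀ p ∈ insert q R, tukeyDepth (insert q R) p = tukeyDepth P p := fun p hp =>
      depth_down' hQP (fun p hp r hr hrQ => by
        have h1 := hnotR r hr (fun h => hrQ (Finset.mem_insert_of_mem h))
        rcases Finset.mem_insert.1 hp with rfl | hp
        · omega
        · exact (hRlt p hp).le.trans h1) hp
    exact ⟨insert q R, genPos_mono hP hQP, hist_insert hqR rfl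
      (by rw [hdn q (Finset.mem_insert_self _ _), heq])
      fun p hp => hdn p (Finset.mem_insert_of_mem hp)⟩
  have hDq : DGE R q i := (dge_lower hqP hqi hgap).mono (by omega)
  by_cases hc : d + 1 ≤ P.card
  · have hS := sgp_of_genPos hP hc
    have hSR := hS.mono hRP
    obtain ⟨w, hw⟩ := exists_ne (0 : E d)
    obtain ⟨a, ha, -, hev⟩ := exists_leave hSR.fib hw hi hDq
    have hspan : ∀ᶠ t in 𝓝[>] a, ∀ S ∈ R.powerset, S.card ≤ d →
        q + t • w ∉ affineSpan ℝ (S : Set (E d)) := by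
      rw [Filter.eventually_all_finset]
      intro S hSR'
      rw [Finset.mem_powerset] at hSR'
      by_cases hcS : S.card ≤ d
      · filter_upwards [eventually_notMem_span w (sgp_notMem (hS.mono hQP) hqR hSR' hcS) a]
          with t ht _ using ht
      · exact Eventually.of_forall fun t h => absurd h hcS
    obtain ⟨t, ⟨ht1, ht2⟩, ht3⟩ := (hev.and hspan).exists
    set x := q + t • w with hx
    have hd1 : 1 ≤ d := by
      by_contra! hd0
      have : d = 0 := by omega
      subst this
      exact hw (Subsingleton.elim _ _)
    have hxR : x ∉ R := by
      intro h
      refine ht3 {x} (Finset.mem_powerset.2 (Finset.singleton_subset_iff.2 h)) (by simpa using hd1) ?_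
      simp
    have hxi := depth_insert_self hxR hi ht1 ht2
    refine ⟨insert x R, (sgp_insert hSR fun S hS' hcS =>
      ht3 S (Finset.mem_powerset.2 hS') hcS).genPos, hist_insert hxR rfl hxi fun p hp => ?_⟩
    rw [← hRd p hp]
    refine (depth_insert hxR hp ?_).symm
    rw [hxi]
    refine (depth_insert_le _ _ _).trans ?_
    rw [hRd p hp]
    exact hRlt p hp
  · have hRc := lower_card hqP hqi hgap
    rw [← hRdef] at hRc
    have hPc : (insert q R).card ≤ P.card := Finset.card_le_card hQP
    rw [Finset.card_insert_of_notMem hqR] at hPc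
    let δ : E d → ℕ := fun p => min (tukeyDepth P p) i
    have hδq : δ q = i := min_eq_right hqi
    have hδR : ∀ p ∈ R, δ p = tukeyDepth P p := fun p hp => min_eq_left (hRlt p hp).le
    obtain ⟨t, ht, -, hhist⟩ := planar_construct δ (insert q R) (by
      intro a ha
      rcases Finset.mem_insert.1 ha with rfl | ha
      · refine ⟨by omega, Or.inr ?_⟩
        refine le_trans (b := R.card) (by omega) (Finset.card_le_card fun b hb => ?_)
        rw [Finset.mem_filter, hδq, hδR b hb]
        exact ⟨Finset.mem_insert_of_mem hb, hRlt b hb⟩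
      · have haP := hRP ha
        rw [hδR a ha]
        have hpos := depth_pos haP
        refine ⟨hpos, ?_⟩
        rcases Nat.lt_or_ge (tukeyDepth P a) 2 with h2 | h2
        · left; omega
        · right
          refine (small_cond hqP hlt hgap haP (hRlt a ha) h2).trans (Finset.card_le_card ?_)
          intro b hb
          rw [Finset.mem_filter] at hb ⊢
          have hbR : b ∈ R := Finset.mem_filter.2 ⟨hb.1, hb.2.trans (hRlt a ha)⟩
          rw [hδR b hbR]
          exact ⟨Finset.mem_insert_of_mem hbR, hb.2⟩)
    have hd2 : 2 ≤ d := by omega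
    obtain ⟨f⟩ := exists_isometry hd2
    set Q := (RN t (insert q R).card).map ⟨f, f.injective⟩ with hQ
    have hQc : Q.card ≤ d := by
      rw [hQ, Finset.card_map, RN_card ht, Finset.card_insert_of_notMem hqR]
      omega
    have key : ∀ j, depthHistogram Q j = (R.filter fun p => tukeyDepth P p = j).card +
        if i = j then 1 else 0 := by
      intro j
      have e : R.filter (fun p => δ p = j) = R.filter (fun p => tukeyDepth P p = j) :=
        Finset.filter_congr fun p hp => by rw [hδR p hp]
      rw [hQ, hist_image, hhist, Finset.filter_insert, hδq, e]
      split_ifs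
      · rw [Finset.card_insert_of_notMem]
        intro h
        exact hqR (Finset.mem_filter.1 h).1
      · rfl
    refine ⟨Q, fun S hS hcS => ?_, fun j hj => ?_, ?_, fun j hj => ?_⟩
    · have := Finset.card_le_card hS
      omega
    · rw [key, if_neg (by omega), hRdef, Finset.filter_filter, add_zero]
      unfold depthHistogram
      congr 1
      apply Finset.filter_congr
      intro x _
      omega
    · rw [key, if_pos rfl, hRdef, Finset.filter_filter, Nat.add_eq_right, Finset.card_eq_zero,
        Finset.filter_eq_empty_iff]
      intro x _
      omega
    · rw [key, if_neg (by omega), hRdef, Finset.filter_filter, add_zero, Finset.card_eq_zero,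
        Finset.filter_eq_empty_iff]
      intro x _
      omega

lemma nontrivial_of_depth {d : ℕ} {P : Finset (E d)} {p : E d} (h : 0 < tukeyDepth P p) :
    Nontrivial (E d) := by
  unfold tukeyDepth at h
  obtain ⟨_, v, hv, -⟩ := Nat.nonempty_of_pos_sInf h
  exact ⟨⟨v, 0, hv⟩⟩

end TukeyAux

/-- If `(a 1, …, a m)` is the depth histogram of a point set in general position in `ℝ^d`,
then for every `i ≤ m` both the truncation `(a 1, …, a i)` and `(a 1, …, a (i-1), 1)` are
depth histograms of point sets in general position in `ℝ^d`. -/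
theorem histogram_truncation {d : ℕ} (P : Finset (EuclideanSpace ℝ (Fin d)))
    (hP : GenPos P) (m : ℕ) (hm : 0 < depthHistogram P m)
    (hsupp : ∀ j, m < j → depthHistogram P j = 0) (i : ℕ) (hi1 : 1 ≤ i) (him : i ≤ m) :
    (∃ Q : Finset (EuclideanSpace ℝ (Fin d)), GenPos Q ∧
      (∀ j ≤ i, depthHistogram Q j = depthHistogram P j) ∧
      (∀ j, i < j → depthHistogram Q j = 0)) ∧
    (∃ Q : Finset (EuclideanSpace ℝ (Fin d)), GenPos Q ∧
      (∀ j < i, depthHistogram Q j = depthHistogram P j) ∧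
      depthHistogram Q i = 1 ∧
      (∀ j, i < j → depthHistogram Q j = 0)) := by
  obtain ⟨p, hp⟩ := Finset.card_pos.1 hm
  rw [Finset.mem_filter] at hp
  have : Nontrivial (TukeyAux.E d) := TukeyAux.nontrivial_of_depth (P := P) (p := p) (by omega)
  exact ⟨TukeyAux.part_one P hP i, TukeyAux.part_two P hP i hi1 ⟨p, hp.1, by omega⟩⟩
end

section
/- Let P ⊂ R^d and let q ∈ P be moved slightly to q' so that the order types of P and P' = (P\{q}) ∪ {q'} differ only in the orientation of the simplex spanned by q and d points p_1,...,p_d of P. Let h be the hyperplane through p_1,...,p_d and q̂ the intersection of h with line qq'. If q̂ ∉ conv{p_1,...,p_d} then td_P(q) = td_{P'}(q'); if q̂ ∈ conv{p_1,...,p_d} then |td_P(q) - td_{P'}(q')| ≤ 1. -/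
open scoped RealInnerProductSpace Classical

/-- The orientation determinant of the `d+1` points `x, g 0, …, g (d-1)` in `ℝ^d`. -/
noncomputable def orient {d : ℕ} (x : EuclideanSpace ℝ (Fin d))
    (g : Fin d → EuclideanSpace ℝ (Fin d)) : ℝ :=
  (Matrix.of fun i j : Fin d => (g i - x) j).det

section Aux

variable {d : ℕ}

/-- Strict separation of the sign pattern `σ` on `R` by a hyperplane through `x`. -/
def SSep (R : Finset (EuclideanSpace ℝ (Fin d))) (σ : EuclideanSpace ℝ (Fin d) → ℝ)
    (x : EuclideanSpace ℝ (Fin d)) : Prop :=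
  ∃ v : EuclideanSpace ℝ (Fin d), ∀ y ∈ R, 0 < σ y * ⟪v, y - x⟫

/-- Weak separation of the sign pattern `σ` on `R` by a hyperplane through `x`. -/
def WSep (R : Finset (EuclideanSpace ℝ (Fin d))) (σ : EuclideanSpace ℝ (Fin d) → ℝ)
    (x : EuclideanSpace ℝ (Fin d)) : Prop :=
  ∃ v : EuclideanSpace ℝ (Fin d), v ≠ 0 ∧ ∀ y ∈ R, 0 ≤ σ y * ⟪v, y - x⟫

/-- The differences `g i - x` are linearly independent. -/
def LI (x : EuclideanSpace ℝ (Fin d)) (g : Fin d → EuclideanSpace ℝ (Fin d)) : Prop :=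
  LinearIndependent ℝ (fun i => g i - x)

lemma orient_ne_zero_iff (x : EuclideanSpace ℝ (Fin d))
    (g : Fin d → EuclideanSpace ℝ (Fin d)) : orient x g ≠ 0 ↔ LI x g := by
  unfold orient LI
  rw [← isUnit_iff_ne_zero, ← Matrix.isUnit_iff_isUnit_det,
    ← Matrix.linearIndependent_rows_iff_isUnit]
  let e := (WithLp.linearEquiv 2 ℝ (Fin d → ℝ)).toLinearMap
  have := LinearMap.linearIndependent_iff (v := fun i => g i - x) e
    (LinearMap.ker_eq_bot.2 (WithLp.linearEquiv 2 ℝ (Fin d → ℝ)).injective)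
  rw [← this]
  rfl

lemma orient_lineMap (hd : 0 < d) (a b : EuclideanSpace ℝ (Fin d)) (t : ℝ)
    (g : Fin d → EuclideanSpace ℝ (Fin d)) :
    orient (AffineMap.lineMap a b t) g = (1 - t) * orient a g + t * orient b g := by
  let k : Fin d := ⟨0, hd⟩
  let M : Matrix (Fin d) (Fin d) ℝ := Matrix.of fun i j => (g i - g k) j
  have key : ∀ x, orient x g = (M.updateRow k (fun j => (g k - x) j)).det := by
    intro x
    unfold orient
    apply Matrix.det_eq_of_forall_row_eq_smul_add_const (fun i => if i = k then 0 else 1) k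
    · simp
    · intro i j
      by_cases h : i = k
      · subst h; simp
      · simp [h, M, Matrix.updateRow_apply]
  rw [key, key, key, ← Matrix.det_updateRow_smul, ← Matrix.det_updateRow_smul,
    ← Matrix.det_updateRow_add]
  congr 2
  ext j
  simp [AffineMap.lineMap_apply]
  ring

lemma exists_inner_eq {u : Fin d → EuclideanSpace ℝ (Fin d)} (hu : LinearIndependent ℝ u)
    (τ : Fin d → ℝ) : ∃ w : EuclideanSpace ℝ (Fin d), ∀ i, ⟪w, u i⟫ = τ i := by
  rcases Nat.eq_zero_or_pos d with rfl | hd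
  · exact ⟨0, fun i => i.elim0⟩
  have : Nonempty (Fin d) := ⟨⟨0, hd⟩⟩
  let b := basisOfLinearIndependentOfCardEqFinrank hu (by simp)
  let f := LinearMap.toContinuousLinearMap (b.constr ℝ τ)
  refine ⟨(InnerProductSpace.toDual ℝ _).symm f, fun i => ?_⟩
  rw [InnerProductSpace.toDual_symm_apply]
  have : u i = b i := by simp [b]
  rw [this]
  simp [f]

lemma eq_zero_of_inner {u : Fin d → EuclideanSpace ℝ (Fin d)} (hu : LinearIndependent ℝ u)
    (v : EuclideanSpace ℝ (Fin d)) (h : ∀ i, ⟪v, u i⟫ = 0) : v = 0 := by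
  rcases Nat.eq_zero_or_pos d with rfl | hd
  · exact Subsingleton.elim _ _
  have : Nonempty (Fin d) := ⟨⟨0, hd⟩⟩
  let b := basisOfLinearIndependentOfCardEqFinrank hu (by simp)
  refine InnerProductSpace.ext_inner_right_basis (𝕜 := ℝ) b fun i => ?_
  simp [b, h]

/-- Perturbation lemma. -/
lemma perturb (R : Finset (EuclideanSpace ℝ (Fin d))) (σ : EuclideanSpace ℝ (Fin d) → ℝ)
    (x v w : EuclideanSpace ℝ (Fin d)) (hv : ∀ y ∈ R, 0 ≤ σ y * ⟪v, y - x⟫)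
    (hw : ∀ y ∈ R, σ y * ⟪v, y - x⟫ = 0 → 0 < σ y * ⟪w, y - x⟫) :
    SSep R σ x := by
  have : ∀ᶠ ε in nhdsWithin (0:ℝ) (Set.Ioi 0), ∀ y ∈ R, 0 < σ y * ⟪v + ε • w, y - x⟫ := by
    rw [Filter.eventually_all_finset]
    intro y hy
    rcases (hv y hy).eq_or_lt with h | h
    · have h2 := hw y hy h.symm
      filter_upwards [self_mem_nhdsWithin] with ε hε
      rw [inner_add_left, real_inner_smul_left]
      have : 0 < ε * (σ y * ⟪w, y - x⟫) := mul_pos hε h2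
      linarith
    · apply nhdsWithin_le_nhds
      have hc : Continuous fun ε : ℝ => σ y * ⟪v + ε • w, y - x⟫ := by fun_prop
      exact (hc.tendsto 0).eventually (lt_mem_nhds (by simpa using h))
  obtain ⟨ε, hε⟩ := this.exists
  exact ⟨_, hε⟩

lemma exists_enum (C : Finset (EuclideanSpace ℝ (Fin d))) (hC : C.card = d) :
    ∃ g : Fin d → EuclideanSpace ℝ (Fin d), Function.Injective g ∧ Set.range g = (C : Set _) := by
  let e := C.equivFinOfCardEq hC
  refine ⟨fun i => (e.symm i : EuclideanSpace ℝ (Fin d)),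
    Subtype.val_injective.comp e.symm.injective, ?_⟩
  ext y
  constructor
  · rintro ⟨i, rfl⟩; exact (e.symm i).2
  · intro hy; exact ⟨e ⟨y, hy⟩, by simp⟩

lemma weak_to_strict (R : Finset (EuclideanSpace ℝ (Fin d))) (hR : d ≤ R.card)
    (σ : EuclideanSpace ℝ (Fin d) → ℝ) (hσ : ∀ y ∈ R, σ y ≠ 0)
    (x v : EuclideanSpace ℝ (Fin d)) (hv0 : v ≠ 0)
    (hv : ∀ y ∈ R, 0 ≤ σ y * ⟪v, y - x⟫)
    (D : Finset (EuclideanSpace ℝ (Fin d))) (hDR : D ⊆ R) (hD : ∀ y ∈ D, ⟪v, y - x⟫ = 0)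
    (hDd : D.card ≤ d)
    (hg : ∀ g : Fin d → EuclideanSpace ℝ (Fin d), Function.Injective g → (∀ i, g i ∈ R) →
      (D : Set _) ⊆ Set.range g → LI x g) : SSep R σ x := by
  set B := R.filter (fun y => ⟪v, y - x⟫ = 0) with hB
  have hDB : D ⊆ B := fun y hy => Finset.mem_filter.2 ⟨hDR hy, hD y hy⟩
  rcases le_total d B.card with h | h
  · exfalso
    obtain ⟨C, hDC, hCB, hC⟩ := Finset.exists_subsuperset_card_eq hDB hDd h
    obtain ⟨g, hgi, hgr⟩ := exists_enum C hC
    have hgB : ∀ i, g i ∈ B := fun i => hCB (by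
      have : g i ∈ (C : Set _) := hgr ▸ Set.mem_range_self i
      exact this)
    refine hv0 (eq_zero_of_inner (hg g hgi (fun i => (Finset.mem_filter.1 (hgB i)).1) ?_) v
      (fun i => (Finset.mem_filter.1 (hgB i)).2))
    rw [hgr]; exact_mod_cast hDC
  · obtain ⟨C, hBC, hCR, hC⟩ := Finset.exists_subsuperset_card_eq (Finset.filter_subset _ R) h hR
    obtain ⟨g, hgi, hgr⟩ := exists_enum C hC
    have hgR : ∀ i, g i ∈ R := fun i => hCR (by
      have : g i ∈ (C : Set _) := hgr ▸ Set.mem_range_self i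
      exact this)
    have hli := hg g hgi hgR (by rw [hgr]; exact_mod_cast hDB.trans hBC)
    obtain ⟨w, hw⟩ := exists_inner_eq hli (fun i => σ (g i))
    refine perturb R σ x v w hv fun y hy h0 => ?_
    have h0' : ⟪v, y - x⟫ = 0 := (mul_eq_zero.1 h0).resolve_left (hσ y hy)
    have : y ∈ (C : Set _) := hBC (Finset.mem_filter.2 ⟨hy, h0'⟩)
    rw [← hgr] at this
    obtain ⟨i, rfl⟩ := this
    rw [hw]
    exact mul_self_pos.2 (hσ _ hy)

lemma isOpen_ssep (R : Finset (EuclideanSpace ℝ (Fin d))) (σ : EuclideanSpace ℝ (Fin d) → ℝ) :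
    IsOpen {x | SSep R σ x} := by
  have : {x | SSep R σ x} = ⋃ v : EuclideanSpace ℝ (Fin d),
      {x | ∀ y ∈ R, 0 < σ y * ⟪v, y - x⟫} := by
    ext x; simp [SSep]
  rw [this]
  refine isOpen_iUnion fun v => ?_
  have : {x : EuclideanSpace ℝ (Fin d) | ∀ y ∈ R, 0 < σ y * ⟪v, y - x⟫} =
    ⋂ y ∈ R, {x | 0 < σ y * ⟪v, y - x⟫} := by ext; simp
  rw [this]
  exact isOpen_biInter_finset fun y _ => isOpen_lt continuous_const (by fun_prop)

lemma closure_ssep (R : Finset (EuclideanSpace ℝ (Fin d))) (hR : R.Nonempty)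
    (σ : EuclideanSpace ℝ (Fin d) → ℝ) :
    closure {x | SSep R σ x} ⊆ {x | WSep R σ x} := by
  let K : Set (Metric.sphere (0 : EuclideanSpace ℝ (Fin d)) 1 × EuclideanSpace ℝ (Fin d)) :=
    {z | ∀ y ∈ R, 0 ≤ σ y * ⟪(z.1 : EuclideanSpace ℝ (Fin d)), y - z.2⟫}
  have hK : IsClosed K := by
    have : K = ⋂ y ∈ R, {z | 0 ≤ σ y * ⟪(z.1 : EuclideanSpace ℝ (Fin d)), y - z.2⟫} := by
      ext; simp [K]
    rw [this]
    exact isClosed_biInter fun y _ => isClosed_le continuous_const (by fun_prop)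
  have hK2 : IsClosed (Prod.snd '' K) := isClosedMap_snd_of_compactSpace _ hK
  have h1 : {x | SSep R σ x} ⊆ Prod.snd '' K := by
    rintro x ⟨v, hv⟩
    have hv0 : v ≠ 0 := by
      rintro rfl
      obtain ⟨y, hy⟩ := hR
      simpa using hv y hy
    have hn : 0 < ‖v‖ := norm_pos_iff.2 hv0
    refine ⟨(⟨‖v‖⁻¹ • v, ?_⟩, x), ?_, rfl⟩
    · simp [norm_smul, hn.ne']
    · intro y hy
      have := hv y hy
      simp only [real_inner_smul_left]
      have : 0 < ‖v‖⁻¹ * (σ y * ⟪v, y - x⟫) := by positivity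
      linarith
  refine (closure_minimal h1 hK2).trans ?_
  rintro x ⟨⟨v, x⟩, hv, rfl⟩
  refine ⟨v, ?_, hv⟩
  intro h
  have := v.2
  simp [h] at this

/-- Number of negative signs of `σ` on `R`. -/
noncomputable def negc (R : Finset (EuclideanSpace ℝ (Fin d)))
    (σ : EuclideanSpace ℝ (Fin d) → ℝ) : ℕ := (R.filter fun y => σ y < 0).card

lemma flip_main (hd : 0 < d) (R : Finset (EuclideanSpace ℝ (Fin d)))
    (q q' : EuclideanSpace ℝ (Fin d)) (pts : Fin d → EuclideanSpace ℝ (Fin d))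
    (hptsR : ∀ i, pts i ∈ R) (hinj : Function.Injective pts)
    (horder : ∀ g : Fin d → EuclideanSpace ℝ (Fin d), Function.Injective g → (∀ i, g i ∈ R) →
      Set.range g ≠ Set.range pts → 0 < orient q g * orient q' g)
    (hflip : orient q pts * orient q' pts < 0)
    (qhat : EuclideanSpace ℝ (Fin d)) (l : Fin d → ℝ) (hl : ∑ i, l i = 1)
    (hql : qhat = ∑ i, l i • pts i) (s : ℝ) (hs : qhat = AffineMap.lineMap q q' s)
    (σ : EuclideanSpace ℝ (Fin d) → ℝ) (hσ : ∀ y, σ y = 1 ∨ σ y = -1) (hS : SSep R σ q) :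
    ∃ σ' : EuclideanSpace ℝ (Fin d) → ℝ, SSep R σ' q' ∧
      negc R σ' ≤ negc R σ + 1 ∧ ((∃ a, l a < 0) → negc R σ' ≤ negc R σ) := by
  set γ : ℝ → EuclideanSpace ℝ (Fin d) := fun t => AffineMap.lineMap q q' t with hγ
  have hγc : Continuous γ := AffineMap.lineMap_continuous
  have hcard : d ≤ R.card := by
    have h1 : (Finset.univ.image pts).card = d := by
      rw [Finset.card_image_of_injective _ hinj]; simp
    exact h1.symm.le.trans <| Finset.card_le_card (by intro y; simp only [Finset.mem_image]; rintro ⟨i, _, rfl⟩; exact hptsR i)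
  have hRne : R.Nonempty := ⟨_, hptsR ⟨0, hd⟩⟩
  -- orientation at `qhat`
  have hzero : orient qhat pts = 0 := by
    unfold orient
    rw [← Matrix.exists_vecMul_eq_zero_iff]
    refine ⟨l, ?_, ?_⟩
    · rintro rfl; simp at hl
    · ext j
      have : qhat j = ∑ i, l i * pts i j := by rw [hql]; simp
      simp only [Matrix.vecMul, dotProduct, Matrix.of_apply, PiLp.sub_apply, Pi.zero_apply,
        mul_sub, Finset.sum_sub_distrib, ← Finset.sum_mul, hl, this]
      ring
  have hor : ∀ t g, orient (γ t) g = (1 - t) * orient q g + t * orient q' g :=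
    fun t g => orient_lineMap hd q q' t g
  have hs0 : (1 - s) * orient q pts + s * orient q' pts = 0 := by
    rw [← hor, hγ]; simp only; rw [← hs, hzero]
  have hs01 : 0 < s ∧ s < 1 := by
    rcases mul_neg_iff.1 hflip with ⟨h1, h2⟩ | ⟨h1, h2⟩ <;> constructor <;> nlinarith
  have hLI1 : ∀ t, 0 ≤ t → t ≤ 1 → ∀ g : Fin d → EuclideanSpace ℝ (Fin d),
      Function.Injective g → (∀ i, g i ∈ R) → Set.range g ≠ Set.range pts → LI (γ t) g := by
    intro t h0 h1 g hg hgR hne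
    rw [← orient_ne_zero_iff, hor]
    rcases mul_pos_iff.1 (horder g hg hgR hne) with ⟨h3, h4⟩ | ⟨h3, h4⟩
    · apply ne_of_gt
      rcases h0.eq_or_lt with rfl | h0
      · simpa using h3
      · have := mul_pos h0 h4
        have := mul_nonneg (sub_nonneg.2 h1) h3.le
        linarith
    · apply ne_of_lt
      rcases h0.eq_or_lt with rfl | h0
      · simpa using h3
      · have := mul_neg_of_pos_of_neg h0 h4
        have := mul_nonpos_of_nonneg_of_nonpos (sub_nonneg.2 h1) h3.le
        linarith
  have hLIp : ∀ t, t ≠ s → LI (γ t) pts := by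
    intro t ht
    rw [← orient_ne_zero_iff, hor]
    intro h
    have : (t - s) * (orient q' pts - orient q pts) = 0 := by linarith
    rcases mul_eq_zero.1 this with h | h
    · exact ht (by linarith)
    · have : orient q' pts = orient q pts := by linarith
      rw [this] at hflip
      nlinarith [mul_self_nonneg (orient q pts)]
  have hLI2 : ∀ t, 0 ≤ t → t ≤ 1 → t ≠ s → ∀ g : Fin d → EuclideanSpace ℝ (Fin d),
      Function.Injective g → (∀ i, g i ∈ R) → LI (γ t) g := by
    intro t h0 h1 hts g hg hgR
    by_cases hne : Set.range g = Set.range pts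
    · have : ∀ i, ∃ j, pts j = g i := fun i => by
        have := Set.mem_range_self (f := g) i
        rwa [hne] at this
      choose e he using this
      have hei : Function.Injective e := fun i j hij => hg (by rw [← he, ← he, hij])
      have := (hLIp t hts).comp e hei
      unfold LI
      convert this using 2
      simp [he]
    · exact hLI1 t h0 h1 g hg hgR hne
  have hσ0 : ∀ σ : EuclideanSpace ℝ (Fin d) → ℝ, (∀ y, σ y = 1 ∨ σ y = -1) → ∀ y, σ y ≠ 0 := by
    intro σ hσ y
    rcases hσ y with h | h <;> rw [h] <;> norm_num
  have hW : ∀ t, 0 ≤ t → t ≤ 1 → t ≠ s → ∀ σ : EuclideanSpace ℝ (Fin d) → ℝ,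
      (∀ y, σ y = 1 ∨ σ y = -1) → WSep R σ (γ t) → SSep R σ (γ t) := by
    rintro t h0 h1 hts σ hσ ⟨v, hv0, hv⟩
    exact weak_to_strict R hcard σ (fun y _ => hσ0 σ hσ y) (γ t) v hv0 hv ∅ (by simp) (by simp)
      (by simp) (fun g hg hgR _ => hLI2 t h0 h1 hts g hg hgR)
  have hseg : ∀ a b, 0 ≤ a → a ≤ b → b ≤ 1 → (∀ t ∈ Set.Icc a b, t ≠ s) →
      ∀ σ : EuclideanSpace ℝ (Fin d) → ℝ, (∀ y, σ y = 1 ∨ σ y = -1) →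
      SSep R σ (γ a) → SSep R σ (γ b) := by
    intro a b ha hab hb hts σ hσ hSa
    have := (isPreconnected_Icc (a := a) (b := b)).subset_of_closure_inter_subset
      (u := γ ⁻¹' {x | SSep R σ x}) ((isOpen_ssep R σ).preimage hγc)
      ⟨a, ⟨le_refl _, hab⟩, hSa⟩ (by
        rintro t ⟨h1, h2⟩
        have h3 := closure_ssep R hRne σ (hγc.closure_preimage_subset _ h1)
        exact hW t (ha.trans h2.1) (h2.2.trans hb) (hts t h2) σ hσ h3)
    exact this ⟨hab, le_refl _⟩
  have hq0 : γ 0 = q := by simp [hγ]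
  have hq1 : γ 1 = q' := by simp [hγ]
  have hsh : γ s = qhat := hs.symm
  -- weak separation at qhat
  have hweak : WSep R σ qhat := by
    rw [← hsh]
    apply closure_ssep R hRne σ
    apply hγc.closure_preimage_subset
    have hsub : Set.Ico 0 s ⊆ γ ⁻¹' {x | SSep R σ x} := by
      intro t ht
      exact hseg 0 t le_rfl ht.1 (ht.2.le.trans hs01.2.le)
        (fun u hu => (hu.2.trans_lt ht.2).ne) σ hσ (by rw [hq0]; exact hS)
    apply closure_mono hsub
    rw [closure_Ico hs01.1.ne]
    exact ⟨hs01.1.le, le_rfl⟩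
  have hafter : ∀ R0 : Finset (EuclideanSpace ℝ (Fin d)), SSep R0 σ qhat →
      ∃ t, s < t ∧ t ≤ 1 ∧ SSep R0 σ (γ t) := by
    intro R0 h
    have h1 : ∀ᶠ t in nhdsWithin s (Set.Ioi s), SSep R0 σ (γ t) := by
      apply nhdsWithin_le_nhds
      exact ((isOpen_ssep R0 σ).preimage hγc).mem_nhds (by
        show SSep R0 σ (γ s)
        rw [hsh]; exact h)
    have h2 : ∀ᶠ t in nhdsWithin s (Set.Ioi s), t ∈ Set.Ioc s 1 := Ioc_mem_nhdsGT hs01.2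
    obtain ⟨t, h3, h4⟩ := (h1.and h2).exists
    exact ⟨t, h4.1, h4.2, h3⟩
  have hfin : ∀ t, s < t → t ≤ 1 → ∀ σ : EuclideanSpace ℝ (Fin d) → ℝ,
      (∀ y, σ y = 1 ∨ σ y = -1) → SSep R σ (γ t) → SSep R σ q' := by
    intro t h1 h2 σ hσ h
    rw [← hq1]
    exact hseg t 1 (hs01.1.trans h1).le h2 le_rfl (fun u hu => (h1.trans_le hu.1).ne') σ hσ h
  have hdone : SSep R σ qhat → ∃ σ' : EuclideanSpace ℝ (Fin d) → ℝ, SSep R σ' q' ∧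
      negc R σ' ≤ negc R σ + 1 ∧ ((∃ a, l a < 0) → negc R σ' ≤ negc R σ) := by
    intro h
    obtain ⟨t, h1, h2, h3⟩ := hafter R h
    exact ⟨σ, hfin t h1 h2 σ hσ h3, by omega, fun _ => le_rfl⟩
  obtain ⟨v, hv0, hv⟩ := hweak
  by_cases hB : ∃ y ∈ R, ⟪v, y - qhat⟫ = 0 ∧ y ∉ Set.range pts
  · obtain ⟨y, hyR, hy0, hyp⟩ := hB
    apply hdone
    refine weak_to_strict R hcard σ (fun y _ => hσ0 σ hσ y) qhat v hv0 hv {y} (by simpa using hyR)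
      (by simpa using hy0) (by rw [Finset.card_singleton]; exact hd) (fun g hg hgR hyg => ?_)
    rw [← hsh]
    refine hLI1 s hs01.1.le hs01.2.le g hg hgR ?_
    intro h
    rw [h] at hyg
    exact hyp (hyg (by simp))
  push Not at hB
  -- the functional with prescribed values
  have hfun : ∀ τ : Fin d → ℝ, ∑ i, l i * τ i = 0 →
      ∃ w : EuclideanSpace ℝ (Fin d), ∀ i, ⟪w, pts i - qhat⟫ = τ i := by
    intro τ hτ
    obtain ⟨w, hw⟩ := exists_inner_eq (hLIp 0 hs01.1.ne) τ
    rw [hq0] at hw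
    refine ⟨w, fun i => ?_⟩
    have h1 : qhat - q = ∑ i, l i • (pts i - q) := by
      simp only [smul_sub, Finset.sum_sub_distrib, ← Finset.sum_smul, hl, one_smul, hql]
    have h2 : ⟪w, qhat - q⟫ = 0 := by
      rw [h1, inner_sum]
      simp only [real_inner_smul_right, hw, hτ]
    have h3 : pts i - qhat = (pts i - q) - (qhat - q) := by abel
    rw [h3, inner_sub_right, hw, h2, sub_zero]
  set S := ∑ i, l i * σ (pts i) with hSdef
  have hfun2 : ∀ j, l j ≠ 0 → ∃ w : EuclideanSpace ℝ (Fin d),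
      ∀ i, ⟪w, pts i - qhat⟫ = σ (pts i) + if i = j then - S / l j else 0 := by
    intro j hj
    apply hfun
    simp only [mul_add, Finset.sum_add_distrib, mul_ite, mul_zero, Finset.sum_ite_eq',
      Finset.mem_univ, if_true, ← hSdef]
    field_simp
    ring
  -- changing the sign at one index only
  have hone : ∀ j, l j ≠ 0 → ∃ σ' : EuclideanSpace ℝ (Fin d) → ℝ, SSep R σ' q' ∧
      ∀ y, y ≠ pts j → σ' y = σ y := by
    intro j hj
    obtain ⟨w, hw⟩ := hfun2 j hj
    have h1 : SSep (R.erase (pts j)) σ qhat := by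
      refine perturb _ σ qhat v w (fun y hy => hv y (Finset.mem_of_mem_erase hy)) ?_
      intro y hy h0
      have h0' := (mul_eq_zero.1 h0).resolve_left (hσ0 σ hσ y)
      obtain ⟨i, rfl⟩ := hB y (Finset.mem_of_mem_erase hy) h0'
      have hij : i ≠ j := fun h => (Finset.mem_erase.1 hy).1 (by rw [h])
      rw [hw, if_neg hij, add_zero]
      exact mul_self_pos.2 (hσ0 σ hσ _)
    obtain ⟨t, ht1, ht2, h2⟩ := hafter _ h1
    by_cases hsub : (R.erase (pts j)).Nonempty
    · obtain ⟨u, hu⟩ := h2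
      have hu0 : u ≠ 0 := by
        rintro rfl
        obtain ⟨y, hy⟩ := hsub
        simpa using hu y hy
      let σ' : EuclideanSpace ℝ (Fin d) → ℝ := fun y =>
        if y = pts j then (if 0 ≤ ⟪u, pts j - γ t⟫ then 1 else -1) else σ y
      have hσ' : ∀ y, σ' y = 1 ∨ σ' y = -1 := by
        intro y
        simp only [σ']
        split_ifs
        · simp
        · simp
        · exact hσ y
      refine ⟨σ', hfin t ht1 ht2 σ' hσ' (hW t (hs01.1.trans ht1).le ht2 ht1.ne' σ' hσ'
        ⟨u, hu0, ?_⟩), ?_⟩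
      · intro y hy
        by_cases hyj : y = pts j
        · subst hyj
          simp only [σ', if_true]
          split_ifs with h
          · simpa using h
          · linarith
        · simp only [σ', if_neg hyj]
          exact (hu y (Finset.mem_erase.2 ⟨hyj, hy⟩)).le
      · intro y hyj
        simp only [σ', if_neg hyj]
    · rw [Finset.not_nonempty_iff_eq_empty] at hsub
      refine ⟨fun y => if y = pts j then 1 else σ y, ?_, fun y hy => by simp [hy]⟩
      have hne : pts j - q' ≠ 0 := by
        have := (hLIp 1 hs01.2.ne').ne_zero j
        rwa [hq1] at this
      refine ⟨pts j - q', fun y hy => ?_⟩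
      have : y = pts j := by
        by_contra h
        have : y ∈ R.erase (pts j) := Finset.mem_erase.2 ⟨h, hy⟩
        rw [hsub] at this
        simp at this
      subst this
      simp only [if_true, one_mul]
      exact real_inner_self_pos.2 hne
  have hcnt : ∀ j, ∀ σ' : EuclideanSpace ℝ (Fin d) → ℝ, (∀ y, y ≠ pts j → σ' y = σ y) →
      negc R σ' ≤ negc R σ + 1 ∧ (σ (pts j) = -1 → negc R σ' ≤ negc R σ) := by
    intro j σ' h
    unfold negc
    constructor
    · refine (Finset.card_le_card (t := insert (pts j) (R.filter fun y => σ y < 0)) ?_).trans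
        (Finset.card_insert_le _ _)
      intro y hy
      rw [Finset.mem_filter] at hy
      by_cases hyj : y = pts j
      · simp [hyj]
      · rw [h y hyj] at hy
        exact Finset.mem_insert_of_mem (Finset.mem_filter.2 hy)
    · intro hj
      apply Finset.card_le_card
      intro y hy
      rw [Finset.mem_filter] at hy ⊢
      refine ⟨hy.1, ?_⟩
      by_cases hyj : y = pts j
      · rw [hyj, hj]; norm_num
      · rw [← h y hyj]; exact hy.2
  obtain ⟨b, hb⟩ : ∃ b, 0 < l b := by
    by_contra! h
    have := Finset.sum_nonpos (fun i (_ : i ∈ Finset.univ) => h i)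
    linarith
  by_cases hneg : ∃ j, l j ≠ 0 ∧ σ (pts j) = -1
  · obtain ⟨j, hj, hjn⟩ := hneg
    obtain ⟨σ', h1, h2⟩ := hone j hj
    exact ⟨σ', h1, (hcnt j σ' h2).1, fun _ => (hcnt j σ' h2).2 hjn⟩
  push Not at hneg
  by_cases ha : ∃ a, l a < 0
  · obtain ⟨a, ha⟩ := ha
    obtain ⟨j, hj, hc⟩ : ∃ j, l j ≠ 0 ∧ 0 ≤ - S / l j := by
      rcases le_total 0 S with h | h
      · exact ⟨a, ha.ne, div_nonneg_of_nonpos (by linarith) ha.le⟩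
      · exact ⟨b, hb.ne', div_nonneg (by linarith) hb.le⟩
    have hj1 : σ (pts j) = 1 := (hσ _).resolve_right (hneg j hj)
    obtain ⟨w, hw⟩ := hfun2 j hj
    apply hdone
    refine perturb _ σ qhat v w hv ?_
    intro y hy h0
    have h0' := (mul_eq_zero.1 h0).resolve_left (hσ0 σ hσ y)
    obtain ⟨i, rfl⟩ := hB y hy h0'
    rw [hw]
    by_cases hij : i = j
    · rw [hij, if_pos rfl, hj1]; linarith
    · rw [if_neg hij, add_zero]
      exact mul_self_pos.2 (hσ0 σ hσ _)
  · obtain ⟨σ', h1, h2⟩ := hone b hb.ne'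
    exact ⟨σ', h1, (hcnt b σ' h2).1, fun h => absurd h ha⟩

/-- Upper bound on the depth from a strict separation. -/
lemma depth_le (R : Finset (EuclideanSpace ℝ (Fin d))) (hR : R.Nonempty)
    (q : EuclideanSpace ℝ (Fin d)) (σ : EuclideanSpace ℝ (Fin d) → ℝ) (h : SSep R σ q) :
    tukeyDepth (insert q R) q ≤ negc R σ + 1 := by
  obtain ⟨v, hv⟩ := h
  have hv0 : v ≠ 0 := by
    rintro rfl
    obtain ⟨y, hy⟩ := hR
    simpa using hv y hy
  have h1 : tukeyDepth (insert q R) q ≤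
      ((insert q R).filter fun x => ⟪v, x⟫ ≤ ⟪v, q⟫).card :=
    Nat.sInf_le ⟨v, hv0, ⟪v, q⟫, le_rfl, rfl⟩
  refine h1.trans ?_
  unfold negc
  refine (Finset.card_le_card (t := insert q (R.filter fun y => σ y < 0)) ?_).trans
        (Finset.card_insert_le _ _)
  intro y hy
  rw [Finset.mem_filter] at hy
  by_cases hyq : y = q
  · simp [hyq]
  have hyR : y ∈ R := (Finset.mem_insert.1 hy.1).resolve_left hyq
  refine Finset.mem_insert_of_mem (Finset.mem_filter.2 ⟨hyR, ?_⟩)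
  have h2 := hv y hyR
  rw [inner_sub_right] at h2
  by_contra! h3
  nlinarith [hy.2]

/-- Lower bound on the depth. -/
lemma le_depth (hd : 0 < d) (R : Finset (EuclideanSpace ℝ (Fin d))) (hR : d ≤ R.card)
    (q : EuclideanSpace ℝ (Fin d)) (hq : q ∉ R)
    (hg : ∀ g : Fin d → EuclideanSpace ℝ (Fin d), Function.Injective g → (∀ i, g i ∈ R) →
      orient q g ≠ 0) :
    ∃ σ : EuclideanSpace ℝ (Fin d) → ℝ, (∀ y, σ y = 1 ∨ σ y = -1) ∧ SSep R σ q ∧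
      negc R σ + 1 ≤ tukeyDepth (insert q R) q := by
  have hne : {n : ℕ | ∃ v : EuclideanSpace ℝ (Fin d), v ≠ 0 ∧ ∃ c : ℝ,
    ⟪v, q⟫ ≤ c ∧ ((insert q R).filter fun x => ⟪v, x⟫ ≤ c).card = n}.Nonempty := by
    have : Nonempty (Fin d) := ⟨⟨0, hd⟩⟩
    obtain ⟨v, hv⟩ := exists_ne (0 : EuclideanSpace ℝ (Fin d))
    exact ⟨_, v, hv, _, le_rfl, rfl⟩
  obtain ⟨v, hv0, c, hc, hn⟩ := Nat.sInf_mem hne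
  let σ : EuclideanSpace ℝ (Fin d) → ℝ := fun y => if ⟪v, y - q⟫ ≤ 0 then -1 else 1
  have hσ : ∀ y, σ y = 1 ∨ σ y = -1 := by
    intro y; simp only [σ]; split_ifs <;> simp
  refine ⟨σ, hσ, ?_, ?_⟩
  · refine weak_to_strict R hR σ (fun y _ => ?_) q v hv0 (fun y _ => ?_) ∅ (by simp) (by simp)
      (by simp) (fun g hgi hgR _ => (orient_ne_zero_iff _ _).1 (hg g hgi hgR))
    · rcases hσ y with h | h <;> rw [h] <;> norm_num
    · simp only [σ]
      split_ifs with h <;> linarith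
  · unfold tukeyDepth negc
    rw [← hn, ← Finset.card_insert_of_notMem (a := q) (s := R.filter fun y => σ y < 0)
      (by simp [hq])]
    apply Finset.card_le_card
    intro y hy
    rw [Finset.mem_filter]
    rcases Finset.mem_insert.1 hy with rfl | hy
    · exact ⟨Finset.mem_insert_self _ _, hc⟩
    · rw [Finset.mem_filter] at hy
      refine ⟨Finset.mem_insert_of_mem hy.1, ?_⟩
      have h2 := hy.2
      simp only [σ] at h2
      split_ifs at h2 with h
      · rw [inner_sub_right] at h; linarith
      · linarith

lemma orient_ne_of_genPos (P : Finset (EuclideanSpace ℝ (Fin d))) (hP : GenPos P)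
    (q : EuclideanSpace ℝ (Fin d)) (hq : q ∈ P) (g : Fin d → EuclideanSpace ℝ (Fin d))
    (hg : Function.Injective g) (hgR : ∀ i, g i ∈ P.erase q) : orient q g ≠ 0 := by
  rw [orient_ne_zero_iff]
  have hqn : q ∉ Finset.univ.image g := by
    simp only [Finset.mem_image, not_exists, not_and]
    intro i _ h
    exact (Finset.mem_erase.1 (hgR i)).1 h
  have hA := hP (insert q (Finset.univ.image g)) (by
    intro y hy
    rcases Finset.mem_insert.1 hy with rfl | hy
    · exact hq
    · obtain ⟨i, _, rfl⟩ := Finset.mem_image.1 hy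
      exact Finset.mem_of_mem_erase (hgR i)) (by
    rw [Finset.card_insert_of_notMem hqn, Finset.card_image_of_injective _ hg]; simp)
  rw [affineIndependent_iff_linearIndependent_vsub ℝ _
    (⟨q, Finset.mem_insert_self _ _⟩ : {x // x ∈ insert q (Finset.univ.image g)})] at hA
  let e : Fin d → {x : {x // x ∈ insert q (Finset.univ.image g)} //
      x ≠ ⟨q, Finset.mem_insert_self _ _⟩} := fun i =>
    ⟨⟨g i, Finset.mem_insert_of_mem (Finset.mem_image_of_mem _ (Finset.mem_univ i))⟩, by
      intro h
      exact (Finset.mem_erase.1 (hgR i)).1 (congrArg Subtype.val h)⟩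
  have he : Function.Injective e := by
    intro i j hij
    apply hg
    have := congrArg (fun z => (z.1.1 : EuclideanSpace ℝ (Fin d))) hij
    simpa [e] using this
  exact hA.comp e he

lemma sign_same {a b : ℝ} (ha : a ≠ 0) (h : Real.sign a = Real.sign b) : 0 < a * b := by
  rcases lt_trichotomy a 0 with h1 | h1 | h1
  · rcases lt_trichotomy b 0 with h2 | h2 | h2
    · exact mul_pos_of_neg_of_neg h1 h2
    · rw [Real.sign_of_neg h1, h2, Real.sign_zero] at h; norm_num at h
    · rw [Real.sign_of_neg h1, Real.sign_of_pos h2] at h; norm_num at h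
  · exact absurd h1 ha
  · rcases lt_trichotomy b 0 with h2 | h2 | h2
    · rw [Real.sign_of_pos h1, Real.sign_of_neg h2] at h; norm_num at h
    · rw [Real.sign_of_pos h1, h2, Real.sign_zero] at h; norm_num at h
    · exact mul_pos h1 h2

end Aux

/-- Moving `q` to `q'` so that the order type changes only in the simplex spanned by
`q` and `p 0, …, p (d-1)`: if the intersection point `q̂` of the hyperplane through the
`p i` with the line `q q'` lies outside `conv {p 0, …, p (d-1)}`, the Tukey depth of the
moved point is unchanged; otherwise it changes by at most 1. -/
theorem depth_under_simplex_flip {d : ℕ} (P : Finset (EuclideanSpace ℝ (Fin d)))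
    (hP : GenPos P) (q q' : EuclideanSpace ℝ (Fin d)) (hq : q ∈ P) (hq' : q' ∉ P)
    (P' : Finset (EuclideanSpace ℝ (Fin d))) (hP' : P' = insert q' (P.erase q))
    (hP'gen : GenPos P')
    (pts : Fin d → EuclideanSpace ℝ (Fin d)) (hptsinj : Function.Injective pts)
    (hptsmem : ∀ i, pts i ∈ P.erase q)
    (horder : ∀ g : Fin d → EuclideanSpace ℝ (Fin d), Function.Injective g →
      (∀ i, g i ∈ P.erase q) → Set.range g ≠ Set.range pts →
      Real.sign (orient q g) = Real.sign (orient q' g))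
    (hflip : Real.sign (orient q pts) = - Real.sign (orient q' pts))
    (hnz : orient q pts ≠ 0)
    (qhat : EuclideanSpace ℝ (Fin d))
    (hqhat1 : qhat ∈ affineSpan ℝ (Set.range pts))
    (hqhat2 : qhat ∈ affineSpan ℝ ({q, q'} : Set (EuclideanSpace ℝ (Fin d)))) :
    (qhat ∉ convexHull ℝ (Set.range pts) → tukeyDepth P q = tukeyDepth P' q') ∧
    (qhat ∈ convexHull ℝ (Set.range pts) →
      |(tukeyDepth P q : ℤ) - (tukeyDepth P' q' : ℤ)| ≤ 1) := by
  rcases Nat.eq_zero_or_pos d with rfl | hd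
  · exact absurd (Subsingleton.elim q q' ▸ hq) hq'
  have hor1 : ∀ g : Fin d → EuclideanSpace ℝ (Fin d), Function.Injective g →
      (∀ i, g i ∈ P.erase q) → orient q g ≠ 0 :=
    fun g hg hgR => orient_ne_of_genPos P hP q hq g hg hgR
  have hsame : ∀ g : Fin d → EuclideanSpace ℝ (Fin d), Function.Injective g →
      (∀ i, g i ∈ P.erase q) → Set.range g ≠ Set.range pts → 0 < orient q g * orient q' g :=
    fun g hg hgR hne => sign_same (hor1 g hg hgR) (horder g hg hgR hne)
  have hopp : orient q pts * orient q' pts < 0 := by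
    have : Real.sign (orient q pts) = Real.sign (-orient q' pts) := by
      rw [hflip, Real.sign_neg]
    have := sign_same hnz this
    linarith
  have hPR : P = insert q (P.erase q) := (Finset.insert_erase hq).symm
  have hqR : q ∉ P.erase q := Finset.notMem_erase q P
  have hq'R : q' ∉ P.erase q := fun h => hq' (Finset.mem_of_mem_erase h)
  have hor2 : ∀ g : Fin d → EuclideanSpace ℝ (Fin d), Function.Injective g →
      (∀ i, g i ∈ P.erase q) → orient q' g ≠ 0 := by
    intro g hg hgR
    apply orient_ne_of_genPos P' hP'gen q' (by rw [hP']; exact Finset.mem_insert_self _ _) g hg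
    intro i
    rw [hP', Finset.erase_insert hq'R]
    exact hgR i
  have key : tukeyDepth P q = tukeyDepth (insert q (P.erase q)) q := by rw [← hPR]
  rw [key, hP']
  clear key hPR
  generalize P.erase q = R at *
  have hcard : d ≤ R.card := by
    have h1 : (Finset.univ.image pts).card = d := by
      rw [Finset.card_image_of_injective _ hptsinj]; simp
    refine h1.symm.le.trans (Finset.card_le_card ?_)
    intro y
    simp only [Finset.mem_image]
    rintro ⟨i, _, rfl⟩
    exact hptsmem i
  have hRne : R.Nonempty := ⟨_, hptsmem ⟨0, hd⟩⟩
  obtain ⟨l, hl, hql⟩ := eq_affineCombination_of_mem_affineSpan_of_fintype hqhat1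
  rw [Finset.affineCombination_eq_linear_combination _ _ _ hl] at hql
  obtain ⟨s, hs⟩ := mem_affineSpan_pair_iff_exists_lineMap_eq.1 hqhat2
  have hneg : qhat ∉ convexHull ℝ (Set.range pts) → ∃ a, l a < 0 := by
    intro h
    by_contra! h2
    apply h
    rw [hql]
    exact (convex_convexHull ℝ _).sum_mem (fun i _ => h2 i) hl
      (fun i _ => subset_convexHull ℝ _ (Set.mem_range_self i))
  obtain ⟨σ₁, h1, h1s, h1d⟩ := le_depth hd R hcard q hqR hor1
  obtain ⟨σ₂, h2, h2s, h2d⟩ := le_depth hd R hcard q' hq'R hor2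
  obtain ⟨τ₁, k1, k1a, k1b⟩ := flip_main hd R q q' pts hptsmem hptsinj hsame hopp qhat l hl hql s
    hs.symm σ₁ h1 h1s
  obtain ⟨τ₂, k2, k2a, k2b⟩ := flip_main hd R q' q pts hptsmem hptsinj
    (fun g a b c => by rw [mul_comm]; exact hsame g a b c) (by rw [mul_comm]; exact hopp)
    qhat l hl hql (1 - s) (by rw [AffineMap.lineMap_apply_one_sub]; exact hs.symm) σ₂ h2 h2s
  have m1 := depth_le R hRne q' τ₁ k1
  have m2 := depth_le R hRne q τ₂ k2
  refine ⟨fun h => ?_, fun _ => ?_⟩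
  · have n1 := k1b (hneg h)
    have n2 := k2b (hneg h)
    omega
  · rw [abs_le]
    constructor <;> omega
end
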